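/- Let n ≥ 21, let 0 < p < 1 be a real number, and set N = (∑_{k=3}^n C(n,k)) + (n−1). A family 𝓐 of subsets of [n] with |𝓐| = N maximises P_p(𝓐) over all families of subsets of [n] of size N if and only if there is a permutation σ of [n] such that 𝓐 = {σ(A) : A ∈ [n]^(≥3) ∪ {A ∈ [n]^(2) : 1 ∈ A}}. That is, [n]^(≥3) ∪ {A ∈ [n]^(2) : 1 ∈ A} is the unique (up to reordering the coordinates) most probably intersecting family of its size, for every p. -/

import Mathlib

open Finset

/-- The ground set `[n] = {1, …, n}`. -/
def groundSet (n : ℕ) : Finset ℕ := Finset.Icc 1 n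

/-- All subsets of `[n]`. -/
def allFams (n : ℕ) : Finset (Finset ℕ) := (groundSet n).powerset

/-- `[n]^(≥ r)`: subsets of `[n]` of size at least `r`. -/
def layerGE (n r : ℕ) : Finset (Finset ℕ) := (allFams n).filter fun A => r ≤ A.card

/-- `[n]^(r)`: subsets of `[n]` of size exactly `r`. -/
def layerEQ (n r : ℕ) : Finset (Finset ℕ) := (groundSet n).powersetCard r

/-- `𝕀^(s)(𝓐)`: the intersecting subfamilies of `𝓐` of size `s`. -/
def interFams (s : ℕ) (𝓐 : Finset (Finset ℕ)) : Finset (Finset (Finset ℕ)) :=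
  (𝓐.powersetCard s).filter fun 𝓔 => ∀ B ∈ 𝓔, ∀ B' ∈ 𝓔, (B ∩ B').Nonempty

/-- `P_p(𝓐)`: the probability that the random subfamily `𝓐(p)` is intersecting. -/
noncomputable def probInter (p : ℝ) (𝓐 : Finset (Finset ℕ)) : ℝ :=
  ∑ 𝓑 ∈ 𝓐.powerset.filter fun 𝓑 => ∀ B ∈ 𝓑, ∀ B' ∈ 𝓑, (B ∩ B').Nonempty,
    p ^ 𝓑.card * (1 - p) ^ (𝓐.card - 𝓑.card)

/-- A family of sets is intersecting if any two of its members meet. -/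
abbrev IsInter (𝓑 : Finset (Finset ℕ)) : Prop := ∀ B ∈ 𝓑, ∀ B' ∈ 𝓑, (B ∩ B').Nonempty

/-- A size-preserving injection between intersecting subfamilies which misses one of them shows
that the probability of being intersecting strictly increases. -/
theorem probInter_lt_of_injOn {p : ℝ} (hp0 : 0 < p) (hp1 : p < 1) {𝓐 𝓐' : Finset (Finset ℕ)}
    (hcard : 𝓐'.card = 𝓐.card) (f : Finset (Finset ℕ) → Finset (Finset ℕ))
    (hsub : ∀ 𝓑 ⊆ 𝓐, IsInter 𝓑 → f 𝓑 ⊆ 𝓐') (hinter : ∀ 𝓑 ⊆ 𝓐, IsInter 𝓑 → IsInter (f 𝓑))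
    (hf : ∀ 𝓑 ⊆ 𝓐, IsInter 𝓑 → (f 𝓑).card = 𝓑.card)
    (hinj : ∀ 𝓑 ⊆ 𝓐, IsInter 𝓑 → ∀ 𝓓 ⊆ 𝓐, IsInter 𝓓 → f 𝓑 = f 𝓓 → 𝓑 = 𝓓)
    (𝓒 : Finset (Finset ℕ)) (h𝓒 : 𝓒 ⊆ 𝓐') (h𝓒i : IsInter 𝓒)
    (hmiss : ∀ 𝓑 ⊆ 𝓐, IsInter 𝓑 → f 𝓑 ≠ 𝓒) :
    probInter p 𝓐 < probInter p 𝓐' := by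
  have hq : 0 < 1 - p := by linarith
  unfold probInter
  set s := 𝓐.powerset.filter IsInter with hs
  set s' := 𝓐'.powerset.filter IsInter with hs'
  have hms : ∀ 𝓑 ∈ s, 𝓑 ⊆ 𝓐 ∧ IsInter 𝓑 := fun 𝓑 h𝓑 => by
    simpa only [hs, mem_filter, mem_powerset] using h𝓑
  have h1 : ∑ 𝓑 ∈ s, p ^ 𝓑.card * (1 - p) ^ (𝓐.card - 𝓑.card)
      = ∑ 𝓑 ∈ s.image f, p ^ 𝓑.card * (1 - p) ^ (𝓐'.card - 𝓑.card) := by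
    rw [sum_image fun 𝓑 h𝓑 𝓓 h𝓓 h => hinj 𝓑 (hms 𝓑 h𝓑).1 (hms 𝓑 h𝓑).2 𝓓 (hms 𝓓 h𝓓).1
      (hms 𝓓 h𝓓).2 h]
    refine sum_congr rfl fun 𝓑 h𝓑 => ?_
    rw [hf 𝓑 (hms 𝓑 h𝓑).1 (hms 𝓑 h𝓑).2, hcard]
  refine h1.trans_lt (sum_lt_sum_of_subset (i := 𝓒) ?_ ?_ ?_ (by positivity)
    fun _ _ _ => by positivity)
  · intro 𝓑 h𝓑
    obtain ⟨𝓓, h𝓓, rfl⟩ := mem_image.1 h𝓑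
    rw [hs', mem_filter, mem_powerset]
    exact ⟨hsub _ (hms _ h𝓓).1 (hms _ h𝓓).2, hinter _ (hms _ h𝓓).1 (hms _ h𝓓).2⟩
  · rw [hs', mem_filter, mem_powerset]
    exact ⟨h𝓒, h𝓒i⟩
  · intro h
    obtain ⟨𝓓, h𝓓, h⟩ := mem_image.1 h
    exact hmiss _ (hms _ h𝓓).1 (hms _ h𝓓).2 h

/-- The effect on a set `W` of the compression given by a permutation `π` and a set `E`. -/
def push (π : Equiv.Perm ℕ) (E W : Finset ℕ) : Finset ℕ := W.image π ∪ E

/-- The members of `𝓑` which have to be pushed once the members of `𝓑` in `𝓚` are pushed. -/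
inductive Forced (π : Equiv.Perm ℕ) (E : Finset ℕ) (𝓚 𝓑 : Finset (Finset ℕ)) : Finset ℕ → Prop
  | base {W : Finset ℕ} : W ∈ 𝓚 → W ∈ 𝓑 → Forced π E 𝓚 𝓑 W
  | step {W W' : Finset ℕ} : Forced π E 𝓚 𝓑 W → W' ∈ 𝓑 → Disjoint W' (push π E W) →
      Forced π E 𝓚 𝓑 W'

section Push

variable {π : Equiv.Perm ℕ} {E : Finset ℕ}

theorem disjoint_push_comm (hπ : ∀ x, π (π x) = x) {W W' : Finset ℕ} (hW : Disjoint W E)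
    (h : Disjoint W' (push π E W)) : Disjoint (push π E W') W := by
  rw [push, disjoint_union_right] at h
  rw [push, disjoint_union_left]
  refine ⟨?_, hW.symm⟩
  rw [Finset.disjoint_left]
  intro x hx hxW
  obtain ⟨y, hy, rfl⟩ := mem_image.1 hx
  refine Finset.disjoint_left.1 h.1 hy (mem_image.2 ⟨_, hxW, hπ y⟩)

theorem image_push_sdiff (hπ : ∀ x, π (π x) = x) (hEπ : ∀ x ∈ E, π x = x) {W : Finset ℕ}
    (hW : Disjoint W E) : (push π E W \ E).image π = W := by
  have h : ∀ x ∈ W, x ∉ E := fun x hx => Finset.disjoint_left.1 hW hx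
  ext x
  simp only [push, mem_image, mem_sdiff, mem_union]
  constructor
  · rintro ⟨y, ⟨⟨z, hz, rfl⟩ | hy, hyE⟩, rfl⟩
    · rwa [hπ]
    · exact absurd hy hyE
  · intro hx
    refine ⟨π x, ⟨Or.inl ⟨x, hx, rfl⟩, fun hE => h x hx ?_⟩, hπ x⟩
    have := hEπ _ hE
    rw [hπ] at this
    rwa [this]

theorem push_injOn (hπ : ∀ x, π (π x) = x) (hEπ : ∀ x ∈ E, π x = x) {W W' : Finset ℕ}
    (hW : Disjoint W E) (hW' : Disjoint W' E) (h : push π E W = push π E W') : W = W' := by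
  rw [← image_push_sdiff hπ hEπ hW, h, image_push_sdiff hπ hEπ hW']

/-- Compressing a family: if the members of `𝓚 ⊆ 𝓐` are replaced by their pushed versions, and
every set which may have to be pushed along stays inside the family, then the probability of
being intersecting strictly increases, provided that some witness `X` is present. -/
theorem probInter_lt_push {p : ℝ} (hp0 : 0 < p) (hp1 : p < 1) (hπ : ∀ x, π (π x) = x)
    (hE : E.Nonempty) (hEπ : ∀ x ∈ E, π x = x) {𝓐 𝓚 𝓛 : Finset (Finset ℕ)} (h𝓚 : 𝓚 ⊆ 𝓛)
    (h𝓛 : 𝓛 ⊆ 𝓐) (hdisj : ∀ W ∈ 𝓛, Disjoint W E) (hnew : ∀ W ∈ 𝓚, push π E W ∉ 𝓐)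
    (hmem : ∀ W ∈ 𝓛, push π E W ∈ 𝓐 \ 𝓚 ∪ 𝓚.image (push π E))
    (hclosed : ∀ W ∈ 𝓛, ∀ W' ∈ 𝓐, (W ∩ W').Nonempty → Disjoint W' (push π E W) → W' ∈ 𝓛)
    {X Y : Finset ℕ} (hY : Y ∈ 𝓚) (hX : X ∈ 𝓐 \ 𝓚) (hXY : Disjoint X Y)
    (hXpush : (X ∩ push π E Y).Nonempty)
    (hXE : E ⊆ X → Disjoint ((X \ E).image π) Y) :
    (𝓐 \ 𝓚 ∪ 𝓚.image (push π E)).card = 𝓐.card ∧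
      probInter p 𝓐 < probInter p (𝓐 \ 𝓚 ∪ 𝓚.image (push π E)) := by
  classical
  have hcard : (𝓐 \ 𝓚 ∪ 𝓚.image (push π E)).card = 𝓐.card := by
    rw [card_union_of_disjoint, card_image_of_injOn, card_sdiff_add_card_eq_card (h𝓚.trans h𝓛)]
    · exact fun W hW W' hW' h => push_injOn hπ hEπ (hdisj _ (h𝓚 hW)) (hdisj _ (h𝓚 hW')) h
    · rw [Finset.disjoint_right]
      intro W hW hW'
      obtain ⟨V, hV, rfl⟩ := mem_image.1 hW
      exact hnew V hV (mem_sdiff.1 hW').1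
  have hFB : ∀ {𝓑 W}, Forced π E 𝓚 𝓑 W → W ∈ 𝓑 := by
    intro 𝓑 W h
    cases h <;> assumption
  have hF𝓛 : ∀ {𝓑 W}, 𝓑 ⊆ 𝓐 → IsInter 𝓑 → Forced π E 𝓚 𝓑 W → W ∈ 𝓛 := by
    intro 𝓑 W h𝓑 hi h
    induction h with
    | base h _ => exact h𝓚 h
    | step h h1 h2 ih => exact hclosed _ ih _ (h𝓑 h1) (hi _ (hFB h) _ h1) h2
  have hpush_not_mem : ∀ {𝓑 W}, 𝓑 ⊆ 𝓐 → IsInter 𝓑 → Forced π E 𝓚 𝓑 W →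
      push π E W ∉ 𝓑 := by
    intro 𝓑 W h𝓑 hi h hW
    cases h with
    | base h _ => exact hnew _ h (h𝓑 hW)
    | step h h1 h2 =>
      exact not_disjoint_iff_nonempty_inter.2 (hi _ hW _ (hFB h))
        (disjoint_push_comm hπ (hdisj _ (hF𝓛 h𝓑 hi h)) h2)
  let f : Finset (Finset ℕ) → Finset (Finset ℕ) := fun 𝓑 =>
    𝓑.filter (fun W => ¬ Forced π E 𝓚 𝓑 W) ∪ (𝓑.filter (Forced π E 𝓚 𝓑)).image (push π E)
  have hmemf : ∀ 𝓑 W, W ∈ f 𝓑 ↔ (W ∈ 𝓑 ∧ ¬ Forced π E 𝓚 𝓑 W) ∨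
      ∃ V, Forced π E 𝓚 𝓑 V ∧ push π E V = W := by
    intro 𝓑 W
    simp only [f, mem_union, mem_filter, mem_image]
    constructor
    · rintro (h | ⟨V, h, rfl⟩)
      · exact Or.inl h
      · exact Or.inr ⟨V, h.2, rfl⟩
    · rintro (h | ⟨V, h, rfl⟩)
      · exact Or.inl h
      · exact Or.inr ⟨V, ⟨hFB h, h⟩, rfl⟩
  have hforced_le : ∀ {𝓑 𝓓 : Finset (Finset ℕ)}, 𝓑 ⊆ 𝓐 → IsInter 𝓑 → 𝓓 ⊆ 𝓐 → IsInter 𝓓 →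
      f 𝓑 = f 𝓓 → ∀ {W}, Forced π E 𝓚 𝓑 W → Forced π E 𝓚 𝓓 W := by
    intro 𝓑 𝓓 h𝓑 hi𝓑 h𝓓 hi𝓓 hf W hW
    have key : ∀ V, Forced π E 𝓚 𝓑 V → push π E V ∉ 𝓓 → Forced π E 𝓚 𝓓 V := by
      intro V hV hnot
      have h1 : push π E V ∈ f 𝓓 := hf ▸ (hmemf _ _).2 (Or.inr ⟨V, hV, rfl⟩)
      rcases (hmemf _ _).1 h1 with h | ⟨V', hV', h⟩
      · exact absurd h.1 hnot
      · rwa [← push_injOn hπ hEπ (hdisj _ (hF𝓛 h𝓓 hi𝓓 hV')) (hdisj _ (hF𝓛 h𝓑 hi𝓑 hV)) h]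
    induction hW with
    | base h h' => exact key _ (Forced.base h h') fun h'' => hnew _ h (h𝓓 h'')
    | step h h1 h2 ih =>
      refine key _ (Forced.step h h1 h2) fun h3 => ?_
      exact not_disjoint_iff_nonempty_inter.2 (hi𝓓 _ h3 _ (hFB ih))
        (disjoint_push_comm hπ (hdisj _ (hF𝓛 h𝓑 hi𝓑 h)) h2)
  refine ⟨hcard, probInter_lt_of_injOn hp0 hp1 hcard f ?_ ?_ ?_ ?_ {push π E Y, X} ?_ ?_ ?_⟩
  · intro 𝓑 h𝓑 hi W hW
    rcases (hmemf _ _).1 hW with h | ⟨V, hV, rfl⟩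
    · exact mem_union_left _ (mem_sdiff.2 ⟨h𝓑 h.1, fun h' => h.2 (Forced.base h' h.1)⟩)
    · exact hmem _ (hF𝓛 h𝓑 hi hV)
  · intro 𝓑 h𝓑 hi
    have hpp : ∀ V V', (push π E V ∩ push π E V').Nonempty := fun V V' =>
      hE.mono (subset_inter subset_union_right subset_union_right)
    have hpn : ∀ V W, Forced π E 𝓚 𝓑 V → W ∈ 𝓑 → ¬ Forced π E 𝓚 𝓑 W →
        (W ∩ push π E V).Nonempty := fun V W hV hW hn =>
      not_disjoint_iff_nonempty_inter.1 fun h => hn (Forced.step hV hW h)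
    intro W hW W' hW'
    rcases (hmemf _ _).1 hW with h | ⟨V, hV, rfl⟩ <;>
      rcases (hmemf _ _).1 hW' with h' | ⟨V', hV', rfl⟩
    · exact hi _ h.1 _ h'.1
    · exact hpn _ _ hV' h.1 h.2
    · rw [inter_comm]
      exact hpn _ _ hV h'.1 h'.2
    · exact hpp _ _
  · intro 𝓑 h𝓑 hi
    simp only [f]
    rw [card_union_of_disjoint, card_image_of_injOn, add_comm, card_filter_add_card_filter_not]
    · intro W hW W' hW' h
      exact push_injOn hπ hEπ (hdisj _ (hF𝓛 h𝓑 hi (mem_filter.1 hW).2))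
        (hdisj _ (hF𝓛 h𝓑 hi (mem_filter.1 hW').2)) h
    · rw [Finset.disjoint_right]
      intro W hW hW'
      obtain ⟨V, hV, rfl⟩ := mem_image.1 hW
      exact hpush_not_mem h𝓑 hi (mem_filter.1 hV).2 (mem_filter.1 hW').1
  · intro 𝓑 h𝓑 hi𝓑 𝓓 h𝓓 hi𝓓 hf
    have hle : ∀ {𝓑 𝓓 : Finset (Finset ℕ)}, 𝓑 ⊆ 𝓐 → IsInter 𝓑 → 𝓓 ⊆ 𝓐 → IsInter 𝓓 →
        f 𝓑 = f 𝓓 → 𝓑 ⊆ 𝓓 := by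
      intro 𝓑 𝓓 h𝓑 hi𝓑 h𝓓 hi𝓓 hf W hW
      by_cases hF : Forced π E 𝓚 𝓑 W
      · exact hFB (hforced_le h𝓑 hi𝓑 h𝓓 hi𝓓 hf hF)
      · have h1 : W ∈ f 𝓓 := hf ▸ (hmemf _ _).2 (Or.inl ⟨hW, hF⟩)
        rcases (hmemf _ _).1 h1 with h | ⟨V, hV, rfl⟩
        · exact h.1
        · exact absurd hW (hpush_not_mem h𝓑 hi𝓑 (hforced_le h𝓓 hi𝓓 h𝓑 hi𝓑 hf.symm hV))
    exact (hle h𝓑 hi𝓑 h𝓓 hi𝓓 hf).antisymm (hle h𝓓 hi𝓓 h𝓑 hi𝓑 hf.symm)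
  · intro W hW
    rcases mem_insert.1 hW with rfl | h
    · exact mem_union_right _ (mem_image_of_mem _ hY)
    · rw [mem_singleton.1 h]
      exact mem_union_left _ hX
  · intro W hW W' hW'
    have h1 : (push π E Y).Nonempty := hXpush.mono inter_subset_right
    have h2 : X.Nonempty := hXpush.mono inter_subset_left
    rcases mem_insert.1 hW with rfl | h <;> rcases mem_insert.1 hW' with rfl | h'
    · simpa using h1
    · rw [mem_singleton.1 h', inter_comm]
      exact hXpush
    · rw [mem_singleton.1 h]
      exact hXpush
    · rw [mem_singleton.1 h, mem_singleton.1 h']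
      simpa using h2
  · intro 𝓑 h𝓑 hi hf
    have hYF : Forced π E 𝓚 𝓑 Y := by
      have h1 : push π E Y ∈ f 𝓑 := hf ▸ mem_insert_self _ _
      rcases (hmemf _ _).1 h1 with h | ⟨V, hV, h⟩
      · exact absurd (h𝓑 h.1) (hnew Y hY)
      · rwa [← push_injOn hπ hEπ (hdisj _ (hF𝓛 h𝓑 hi hV)) (hdisj _ (h𝓚 hY)) h]
    have h1 : X ∈ f 𝓑 := hf ▸ mem_insert_of_mem (mem_singleton_self _)
    rcases (hmemf _ _).1 h1 with h | ⟨V, hV, rfl⟩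
    · exact not_disjoint_iff_nonempty_inter.2 (hi _ h.1 _ (hFB hYF)) hXY
    · have := hXE subset_union_right
      rw [image_push_sdiff hπ hEπ (hdisj _ (hF𝓛 h𝓑 hi hV))] at this
      exact not_disjoint_iff_nonempty_inter.2 (hi _ (hFB hV) _ (hFB hYF)) this

end Push

/-- The families maximising the probability of being intersecting, among families of their size. -/
def IsOptimal (n : ℕ) (p : ℝ) (𝓐 : Finset (Finset ℕ)) : Prop :=
  𝓐 ⊆ allFams n ∧ ∀ 𝓐' ⊆ allFams n, 𝓐'.card = 𝓐.card → probInter p 𝓐' ≤ probInter p 𝓐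

theorem mem_allFams {n : ℕ} {A : Finset ℕ} : A ∈ allFams n ↔ A ⊆ groundSet n := mem_powerset

theorem card_groundSet (n : ℕ) : (groundSet n).card = n := by simp [groundSet]

/-- If few sets are missing from `𝓐`, then `𝓐` has a member containing `v` and avoiding `D`. -/
theorem exists_mem_disjoint {n : ℕ} {𝓐 : Finset (Finset ℕ)} {D : Finset ℕ} {v : ℕ}
    (hv : v ∈ groundSet n) (hD : D ⊆ groundSet n) (hvD : v ∉ D)
    (h : (allFams n \ 𝓐).card < 2 ^ (n - 1 - D.card)) : ∃ X ∈ 𝓐, v ∈ X ∧ Disjoint X D := by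
  by_contra! hcon
  refine h.not_ge ?_
  have hins : insert v D ⊆ groundSet n := insert_subset hv hD
  have hc : (groundSet n \ insert v D).card = n - 1 - D.card := by
    rw [card_sdiff_of_subset hins, card_groundSet, card_insert_of_notMem hvD]
    omega
  rw [← hc, ← card_powerset, ← card_image_of_injOn (f := insert v)
    (s := (groundSet n \ insert v D).powerset)]
  · refine card_le_card fun X hX => ?_
    obtain ⟨Z, hZ, rfl⟩ := mem_image.1 hX
    rw [mem_powerset, subset_sdiff] at hZ
    refine mem_sdiff.2 ⟨mem_allFams.2 (insert_subset hv hZ.1), fun hmem => ?_⟩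
    refine hcon _ hmem (mem_insert_self _ _) ?_
    rw [disjoint_insert_left]
    exact ⟨hvD, hZ.2.mono_right (subset_insert _ _)⟩
  · intro Z hZ Z' hZ' hh
    simp only [coe_powerset, Set.mem_preimage, Set.mem_powerset_iff, coe_subset,
      subset_sdiff, disjoint_insert_right] at hZ hZ'
    rw [← erase_insert hZ.2.1, ← erase_insert hZ'.2.1]
    exact congrArg (fun s => s.erase v) hh

section Optimal

variable {n : ℕ} {p : ℝ} {𝓐 : Finset (Finset ℕ)}

/-- Compressing an optimal family strictly is impossible. -/
theorem IsOptimal.false_of_push (hopt : IsOptimal n p 𝓐) (hp0 : 0 < p) (hp1 : p < 1)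
    {π : Equiv.Perm ℕ} {E : Finset ℕ} (hπ : ∀ x, π (π x) = x)
    (hE : E.Nonempty) (hEπ : ∀ x ∈ E, π x = x) {𝓚 𝓛 : Finset (Finset ℕ)} (h𝓚 : 𝓚 ⊆ 𝓛)
    (h𝓛 : 𝓛 ⊆ 𝓐) (hdisj : ∀ W ∈ 𝓛, Disjoint W E) (hnew : ∀ W ∈ 𝓚, push π E W ∉ 𝓐)
    (hground : ∀ W ∈ 𝓚, push π E W ⊆ groundSet n)
    (hmem : ∀ W ∈ 𝓛, W ∉ 𝓚 → push π E W ∈ 𝓐 \ 𝓚)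
    (hclosed : ∀ W ∈ 𝓛, ∀ W' ∈ 𝓐, (W ∩ W').Nonempty → Disjoint W' (push π E W) → W' ∈ 𝓛)
    {X Y : Finset ℕ} (hY : Y ∈ 𝓚) (hX : X ∈ 𝓐 \ 𝓚) (hXY : Disjoint X Y)
    (hXpush : (X ∩ push π E Y).Nonempty)
    (hXE : E ⊆ X → Disjoint ((X \ E).image π) Y) : False := by
  obtain ⟨h1, h2⟩ := probInter_lt_push hp0 hp1 hπ hE hEπ h𝓚 h𝓛 hdisj hnew (fun W hW => by
    by_cases hW𝓚 : W ∈ 𝓚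
    · exact mem_union_right _ (mem_image_of_mem _ hW𝓚)
    · exact mem_union_left _ (hmem W hW hW𝓚)) hclosed hY hX hXY hXpush hXE
  refine h2.not_ge (hopt.2 _ (union_subset (sdiff_subset.trans hopt.1) fun W hW => ?_) h1)
  obtain ⟨V, hV, rfl⟩ := mem_image.1 hW
  exact mem_allFams.2 (hground V hV)

theorem IsOptimal.mem_of_subset_of_small (hopt : IsOptimal n p 𝓐) (hp0 : 0 < p) (hp1 : p < 1)
    {Y T : Finset ℕ} (hY : Y ∈ 𝓐) (hYT : Y ⊆ T) (hT : T ⊆ groundSet n)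
    (hM : (allFams n \ 𝓐).card < 2 ^ (n - 1 - Y.card)) : T ∈ 𝓐 := by
  by_contra hTA
  obtain ⟨v, hvT, hvY⟩ : ∃ v ∈ T, v ∉ Y := by
    by_contra! h
    exact hTA (hYT.antisymm h ▸ hY)
  have hpush : push 1 (T \ Y) Y = T := by
    simp [push, hYT]
  obtain ⟨X, hX, hvX, hXY⟩ := exists_mem_disjoint (hT hvT) (hYT.trans hT) hvY hM
  have hvE : v ∈ T \ Y := mem_sdiff.2 ⟨hvT, hvY⟩
  refine hopt.false_of_push hp0 hp1 (π := 1) (E := T \ Y) (𝓚 := {Y}) (𝓛 := {Y}) (X := X) (Y := Y)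
    (fun _ => rfl) ⟨v, hvE⟩ (fun _ _ => rfl) Subset.rfl (by simpa using hY)
    (by simpa using disjoint_sdiff) ?_ ?_ ?_ ?_ (mem_singleton_self _) ?_ hXY ?_ ?_
  · simpa [hpush] using hTA
  · simpa [hpush] using hT
  · intro W hW hW'
    exact absurd hW hW'
  · intro W hW W' _ h1 h2
    rw [mem_singleton.1 hW] at h1 h2
    rw [hpush] at h2
    rw [inter_comm] at h1
    exact absurd (h2.mono_right hYT) (not_disjoint_iff_nonempty_inter.2 h1)
  · refine mem_sdiff.2 ⟨hX, fun h => ?_⟩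
    rw [mem_singleton.1 h] at hvX
    exact hvY hvX
  · rw [hpush]
    exact ⟨v, mem_inter.2 ⟨hvX, hvT⟩⟩
  · intro _
    simpa using hXY.mono_left sdiff_subset

/-- A set missing from an optimal family is small, since all of its subsets are missing. -/
theorem IsOptimal.two_pow_card_le (hopt : IsOptimal n p 𝓐) (hp0 : 0 < p) (hp1 : p < 1)
    (hn : 2 ≤ n) (hM : (allFams n \ 𝓐).card ^ 2 < 2 ^ (n - 2)) {T : Finset ℕ}
    (hT : T ⊆ groundSet n) (hTA : T ∉ 𝓐) :
    2 ^ T.card ≤ (allFams n \ 𝓐).card ∧ ∀ Y ⊆ T, Y ∉ 𝓐 := by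
  set M := (allFams n \ 𝓐).card with hMdef
  set k := (n - 1) / 2 with hk
  have hMk : M < 2 ^ k := by
    refine lt_of_pow_lt_pow_left₀ 2 (by positivity) (hM.trans_le ?_)
    rw [← pow_mul]
    exact Nat.pow_le_pow_right (by norm_num) (by omega)
  have hlow : ∀ Y ⊆ T, Y.card ≤ k → Y ∉ 𝓐 := fun Y hY hYk hYA =>
    hTA (hopt.mem_of_subset_of_small hp0 hp1 hYA hY hT
      (hMk.trans_le (Nat.pow_le_pow_right (by norm_num) (by omega))))
  have hcount : ∀ Y ⊆ T, Y.card ≤ k → 2 ^ Y.card ≤ M := by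
    intro Y hY hYk
    rw [← card_powerset]
    refine card_le_card fun Z hZ => ?_
    rw [mem_powerset] at hZ
    exact mem_sdiff.2 ⟨mem_allFams.2 (hZ.trans (hY.trans hT)),
      hlow _ (hZ.trans hY) ((card_le_card hZ).trans hYk)⟩
  have hTk : T.card ≤ k := by
    by_contra! h
    obtain ⟨Y, hY, hYk⟩ := exists_subset_card_eq h.le
    have := hcount Y hY hYk.le
    rw [hYk] at this
    omega
  exact ⟨hcount T Subset.rfl hTk, fun Y hY => hlow Y hY ((card_le_card hY).trans hTk)⟩

theorem IsOptimal.mem_of_subset (hopt : IsOptimal n p 𝓐) (hp0 : 0 < p) (hp1 : p < 1)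
    (hn : 2 ≤ n) (hM : (allFams n \ 𝓐).card ^ 2 < 2 ^ (n - 2)) {Y T : Finset ℕ}
    (hY : Y ∈ 𝓐) (hYT : Y ⊆ T) (hT : T ⊆ groundSet n) : T ∈ 𝓐 := by
  by_contra h
  exact (hopt.two_pow_card_le hp0 hp1 hn hM hT h).2 Y hYT hY

/-- In an optimal family, an element of a member may be replaced by two new elements. -/
theorem IsOptimal.replace_mem (hopt : IsOptimal n p 𝓐) (hp0 : 0 < p) (hp1 : p < 1)
    (hn : 2 ≤ n) (hM : (allFams n \ 𝓐).card ^ 2 < 2 ^ (n - 2)) {Y : Finset ℕ} {a b c : ℕ}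
    (hY : Y ∈ 𝓐) (ha : a ∈ Y) (hb : b ∉ Y) (hc : c ∉ Y) (hbc : b ≠ c) (hbn : b ∈ groundSet n)
    (hcn : c ∈ groundSet n) : insert b (insert c (Y.erase a)) ∈ 𝓐 := by
  have hab : a ≠ b := fun h => hb (h ▸ ha)
  have hac : a ≠ c := fun h => hc (h ▸ ha)
  have hpush : ∀ W : Finset ℕ, a ∈ W → b ∉ W → c ∉ W →
      push (Equiv.swap a b) {c} W = insert b (insert c (W.erase a)) := by
    intro W haW hbW hcW
    ext x
    simp only [push, mem_union, mem_image, mem_singleton, mem_insert, mem_erase]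
    constructor
    · rintro (⟨y, hy, rfl⟩ | rfl)
      · by_cases hya : y = a
        · simp [hya]
        · have hyb : y ≠ b := fun h => hbW (h ▸ hy)
          rw [Equiv.swap_apply_of_ne_of_ne hya hyb]
          exact Or.inr (Or.inr ⟨hya, hy⟩)
      · simp
    · rintro (rfl | rfl | ⟨h1, h2⟩)
      · exact Or.inl ⟨a, haW, by simp⟩
      · exact Or.inr rfl
      · exact Or.inl ⟨x, h2, Equiv.swap_apply_of_ne_of_ne h1 fun h => hbW (h ▸ h2)⟩
  by_contra hmiss
  have hYn := mem_allFams.1 (hopt.1 hY)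
  have hsub : insert b (insert c (Y.erase a)) ⊆ groundSet n :=
    insert_subset hbn (insert_subset hcn ((erase_subset _ _).trans hYn))
  have hYcard : (insert b (insert c (Y.erase a))).card = Y.card + 1 := by
    rw [card_insert_of_notMem, card_insert_of_notMem, card_erase_add_one ha]
    · simp [hc]
    · simp [hbc, hb]
  obtain ⟨hsmall, -⟩ := hopt.two_pow_card_le hp0 hp1 hn hM hsub hmiss
  rw [hYcard] at hsmall
  obtain ⟨X, hX, hcX, hXD⟩ : ∃ X ∈ 𝓐, c ∈ X ∧ Disjoint X (insert b Y) := by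
    refine exists_mem_disjoint hcn (insert_subset hbn hYn) (by simp [hc, hbc.symm]) ?_
    rw [card_insert_of_notMem hb]
    by_contra! h
    have h1 : 2 ^ (n - 2) ≤ (allFams n \ 𝓐).card ^ 2 := by
      calc 2 ^ (n - 2) ≤ 2 ^ (n - 1 - (Y.card + 1) + (Y.card + 1)) :=
            Nat.pow_le_pow_right (by norm_num) (by omega)
        _ = 2 ^ (n - 1 - (Y.card + 1)) * 2 ^ (Y.card + 1) := pow_add _ _ _
        _ ≤ _ := by rw [sq]; exact Nat.mul_le_mul h hsmall
    omega
  rw [disjoint_insert_right] at hXD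
  have haX : a ∉ X := fun h => Finset.disjoint_left.1 hXD.2 h ha
  let 𝓛 := 𝓐.filter fun W => a ∈ W ∧ b ∉ W ∧ c ∉ W
  let 𝓚 := 𝓛.filter fun W => push (Equiv.swap a b) {c} W ∉ 𝓐
  have hm𝓛 : ∀ {W}, W ∈ 𝓛 ↔ W ∈ 𝓐 ∧ a ∈ W ∧ b ∉ W ∧ c ∉ W := by simp [𝓛]
  have hm𝓚 : ∀ {W}, W ∈ 𝓚 ↔ W ∈ 𝓛 ∧ push (Equiv.swap a b) {c} W ∉ 𝓐 := by simp [𝓚]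
  refine hopt.false_of_push hp0 hp1 (π := Equiv.swap a b) (E := {c}) (𝓚 := 𝓚) (𝓛 := 𝓛)
    (X := X) (Y := Y) (by simp) ⟨c, mem_singleton_self _⟩ ?_ (filter_subset _ _)
    (filter_subset _ _) ?_ ?_ ?_ ?_ ?_ ?_ ?_ hXD.2 ?_ ?_
  · intro x hx
    rw [mem_singleton.1 hx, Equiv.swap_apply_of_ne_of_ne hac.symm hbc.symm]
  · intro W hW
    rw [disjoint_singleton_right]
    exact (hm𝓛.1 hW).2.2.2
  · exact fun W hW => (hm𝓚.1 hW).2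
  · intro W hW
    obtain ⟨h1, h2, h3, h4⟩ := hm𝓛.1 (hm𝓚.1 hW).1
    rw [hpush W h2 h3 h4]
    exact insert_subset hbn (insert_subset hcn
      ((erase_subset _ _).trans (mem_allFams.1 (hopt.1 h1))))
  · intro W hW hW'
    obtain ⟨h1, h2, h3, h4⟩ := hm𝓛.1 hW
    refine mem_sdiff.2 ⟨?_, fun h => ?_⟩
    · by_contra h
      exact hW' (hm𝓚.2 ⟨hW, h⟩)
    · rw [hpush W h2 h3 h4] at h
      exact (hm𝓛.1 (hm𝓚.1 h).1).2.2.1 (mem_insert_self _ _)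
  · intro W hW W' hW' h hd
    obtain ⟨h1, h2, h3, h4⟩ := hm𝓛.1 hW
    rw [hpush W h2 h3 h4, disjoint_insert_right, disjoint_insert_right] at hd
    refine hm𝓛.2 ⟨hW', ?_, hd.1, hd.2.1⟩
    obtain ⟨x, hx⟩ := h
    rw [mem_inter] at hx
    by_cases hxa : x = a
    · exact hxa ▸ hx.2
    · exact absurd (mem_erase.2 ⟨hxa, hx.1⟩) (Finset.disjoint_left.1 hd.2.2 hx.2)
  · refine hm𝓚.2 ⟨hm𝓛.2 ⟨hY, ha, hb, hc⟩, ?_⟩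
    rwa [hpush Y ha hb hc]
  · exact mem_sdiff.2 ⟨hX, fun h => haX (hm𝓛.1 (hm𝓚.1 h).1).2.1⟩
  · exact ⟨c, mem_inter.2 ⟨hcX, mem_union_right _ (mem_singleton_self _)⟩⟩
  · intro _
    rw [Finset.disjoint_left]
    intro x hx
    obtain ⟨y, hy, rfl⟩ := mem_image.1 hx
    have hyX := (mem_sdiff.1 hy).1
    rw [Equiv.swap_apply_of_ne_of_ne (ne_of_mem_of_not_mem hyX haX)
      (ne_of_mem_of_not_mem hyX hXD.1)]
    exact Finset.disjoint_left.1 hXD.2 hyX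

theorem lt_choose_two {n : ℕ} (hn : 21 ≤ n) : n < n.choose 2 := by
  rw [Nat.choose_two_right]
  have h : 20 * n ≤ n * (n - 1) := by
    rw [mul_comm]
    exact Nat.mul_le_mul_left _ (by omega)
  omega

/-- The members of an optimal family with `n.choose 2 + 2` missing sets have at least two
elements. -/
theorem IsOptimal.two_le_card (hopt : IsOptimal n p 𝓐) (hp0 : 0 < p) (hp1 : p < 1)
    (hn : 21 ≤ n) (hM : (allFams n \ 𝓐).card ^ 2 < 2 ^ (n - 2))
    (hmiss : (allFams n \ 𝓐).card = n.choose 2 + 2) {Y : Finset ℕ} (hY : Y ∈ 𝓐) :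
    2 ≤ Y.card := by
  by_contra! hcard
  have hYn := mem_allFams.1 (hopt.1 hY)
  have hn2 : 2 ≤ n := by omega
  obtain ⟨a, ha, hYa⟩ : ∃ a ∈ groundSet n, Y ⊆ {a} := by
    rcases Y.eq_empty_or_nonempty with rfl | ⟨a, ha⟩
    · exact ⟨1, by simp [groundSet]; omega, empty_subset _⟩
    · refine ⟨a, hYn ha, fun x hx => mem_singleton.2 ?_⟩
      exact card_le_one.1 (by omega) x hx a ha
  have haA : {a} ∈ 𝓐 := hopt.mem_of_subset hp0 hp1 hn2 hM hY hYa (singleton_subset_iff.2 ha)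
  have hsub : allFams n \ 𝓐 ⊆ insert ∅ ((groundSet n).image fun x => {x}) := by
    intro Z hZ
    rw [mem_sdiff, mem_allFams] at hZ
    by_contra hcon
    simp only [mem_insert, mem_image, not_or, not_exists, not_and] at hcon
    have hZ2 : 1 < Z.card := by
      by_contra! h
      obtain ⟨z, hz⟩ := nonempty_iff_ne_empty.2 hcon.1
      exact hcon.2 z (hZ.1 hz) (eq_singleton_iff_unique_mem.2
        ⟨hz, fun y hy => card_le_one.1 h y hy z hz⟩).symm
    by_cases haZ : a ∈ Z
    · exact hZ.2 (hopt.mem_of_subset hp0 hp1 hn2 hM haA (singleton_subset_iff.2 haZ) hZ.1)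
    · obtain ⟨b, hb, c, hc, hbc⟩ := one_lt_card.1 hZ2
      have h := hopt.replace_mem hp0 hp1 hn2 hM haA (mem_singleton_self a)
        (b := b) (c := c) (by rintro h; exact haZ (mem_singleton.1 h ▸ hb))
        (by rintro h; exact haZ (mem_singleton.1 h ▸ hc)) hbc (hZ.1 hb) (hZ.1 hc)
      refine hZ.2 (hopt.mem_of_subset hp0 hp1 hn2 hM h ?_ hZ.1)
      simp [insert_subset_iff, hb, hc]
  have h1 := (card_le_card hsub).trans (card_insert_le _ _)
  have h2 : ((groundSet n).image fun x => ({x} : Finset ℕ)).card ≤ n :=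
    card_image_le.trans (card_groundSet n).le
  have h3 := lt_choose_two hn
  omega

/-- In an optimal family, a missing set of size at least three avoids the pairs of the family. -/
theorem IsOptimal.disjoint_of_notMem (hopt : IsOptimal n p 𝓐) (hp0 : 0 < p) (hp1 : p < 1)
    (hn : 2 ≤ n) (hM : (allFams n \ 𝓐).card ^ 2 < 2 ^ (n - 2)) {e T : Finset ℕ}
    (he : e ∈ 𝓐) (he2 : e.card = 2) (hT : T ⊆ groundSet n) (hT3 : 3 ≤ T.card) (hTA : T ∉ 𝓐) :
    Disjoint e T := by
  have key : ∀ d a, d ≠ a → e = {d, a} → d ∉ T := by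
    rintro d a hda rfl hd
    have ha : a ∉ T := fun ha => hTA (hopt.mem_of_subset hp0 hp1 hn hM he
      (insert_subset hd (singleton_subset_iff.2 ha)) hT)
    obtain ⟨b, hb, c, hc, hbc⟩ := one_lt_card.1 (show 1 < (T.erase d).card by
      rw [card_erase_of_mem hd]
      omega)
    rw [mem_erase] at hb hc
    have h := hopt.replace_mem hp0 hp1 hn hM he (a := a) (b := b) (c := c) (by simp)
      (by simp [hb.1, ne_of_mem_of_not_mem hb.2 ha])
      (by simp [hc.1, ne_of_mem_of_not_mem hc.2 ha]) hbc (hT hb.2) (hT hc.2)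
    refine hTA (hopt.mem_of_subset hp0 hp1 hn hM h ?_ hT)
    intro x hx
    simp only [mem_insert, mem_erase, mem_singleton] at hx
    rcases hx with rfl | rfl | ⟨h1, rfl | h2⟩
    · exact hb.2
    · exact hc.2
    · exact hd
    · exact absurd h2 h1
  obtain ⟨u, v, huv, rfl⟩ := card_eq_two.1 he2
  rw [disjoint_insert_left, disjoint_singleton_left]
  exact ⟨key u v huv rfl, key v u huv.symm (pair_comm _ _)⟩

/-- An optimal family containing a pair contains every set of size at least three. -/
theorem IsOptimal.mem_of_three_le_card (hopt : IsOptimal n p 𝓐) (hp0 : 0 < p) (hp1 : p < 1)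
    (hn : 9 ≤ n) (hM : (allFams n \ 𝓐).card ^ 2 < 2 ^ (n - 2))
    (h𝓐2 : ∀ Y ∈ 𝓐, 2 ≤ Y.card) {e : Finset ℕ} (he : e ∈ 𝓐) (he2 : e.card = 2)
    {S : Finset ℕ} (hS : S ⊆ groundSet n) (hS3 : 3 ≤ S.card) : S ∈ 𝓐 := by
  by_contra hSA
  have hn2 : 2 ≤ n := by omega
  obtain ⟨T, hTmem, hTmax⟩ := exists_max_image ((allFams n \ 𝓐).filter fun T => 3 ≤ T.card) card
    ⟨S, mem_filter.2 ⟨mem_sdiff.2 ⟨mem_allFams.2 hS, hSA⟩, hS3⟩⟩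
  rw [mem_filter, mem_sdiff, mem_allFams] at hTmem
  obtain ⟨⟨hT, hTA⟩, hT3⟩ := hTmem
  have hup := fun {Y Z : Finset ℕ} (hY : Y ∈ 𝓐) (hYZ : Y ⊆ Z) (hZ : Z ⊆ groundSet n) =>
    hopt.mem_of_subset hp0 hp1 hn2 hM hY hYZ hZ
  have heT := hopt.disjoint_of_notMem hp0 hp1 hn2 hM he he2 hT hT3 hTA
  have hen := mem_allFams.1 (hopt.1 he)
  obtain ⟨u, v, huv, huve⟩ := card_eq_two.1 he2
  obtain ⟨s, t, ε, hs, ht, hε, hst, hsε, htε⟩ := two_lt_card_iff.1 hT3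
  have hu : u ∈ e := by simp [huve]
  have hv : v ∈ e := by simp [huve]
  have hne : ∀ {x y}, x ∈ e → y ∈ T → x ≠ y := fun hx hy h =>
    Finset.disjoint_left.1 heT hx (h ▸ hy)
  set π : Equiv.Perm ℕ := Equiv.swap u s * Equiv.swap v t with hπdef
  have hus := hne hu hs
  have hut := hne hu ht
  have hvs := hne hv hs
  have hvt := hne hv ht
  have hπu : π u = s := by
    rw [hπdef, Equiv.Perm.mul_apply, Equiv.swap_apply_of_ne_of_ne huv hut, Equiv.swap_apply_left]
  have hπv : π v = t := by
    rw [hπdef, Equiv.Perm.mul_apply, Equiv.swap_apply_left,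
      Equiv.swap_apply_of_ne_of_ne hut.symm hst.symm]
  have hπs : π s = u := by
    rw [hπdef, Equiv.Perm.mul_apply, Equiv.swap_apply_of_ne_of_ne hvs.symm hst,
      Equiv.swap_apply_right]
  have hπt : π t = v := by
    rw [hπdef, Equiv.Perm.mul_apply, Equiv.swap_apply_right,
      Equiv.swap_apply_of_ne_of_ne huv.symm hvs]
  have hπx : ∀ x, x ≠ u → x ≠ v → x ≠ s → x ≠ t → π x = x := by
    intro x h1 h2 h3 h4
    rw [hπdef, Equiv.Perm.mul_apply, Equiv.swap_apply_of_ne_of_ne h2 h4,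
      Equiv.swap_apply_of_ne_of_ne h1 h3]
  have hππ : ∀ x, π (π x) = x := by
    intro x
    by_cases h1 : x = u
    · rw [h1, hπu, hπs]
    by_cases h2 : x = v
    · rw [h2, hπv, hπt]
    by_cases h3 : x = s
    · rw [h3, hπs, hπu]
    by_cases h4 : x = t
    · rw [h4, hπt, hπv]
    rw [hπx x h1 h2 h3 h4, hπx x h1 h2 h3 h4]
  have hπn : ∀ x ∈ groundSet n, π x ∈ groundSet n := by
    intro x hx
    by_cases h1 : x = u
    · rw [h1, hπu]; exact hT hs
    by_cases h2 : x = v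
    · rw [h2, hπv]; exact hT ht
    by_cases h3 : x = s
    · rw [h3, hπs]; exact hen hu
    by_cases h4 : x = t
    · rw [h4, hπt]; exact hen hv
    rwa [hπx x h1 h2 h3 h4]
  set E := (T.erase s).erase t with hEdef
  have hεE : ε ∈ E := mem_erase.2 ⟨htε.symm, mem_erase.2 ⟨hsε.symm, hε⟩⟩
  have hET : E ⊆ T := (erase_subset _ _).trans (erase_subset _ _)
  have hEπ : ∀ x ∈ E, π x = x := by
    intro x hx
    have hx' := hx
    rw [hEdef, mem_erase, mem_erase] at hx'
    exact hπx x (hne hu hx'.2.2).symm (hne hv hx'.2.2).symm hx'.2.1 hx'.1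
  have hTE : T = insert s (insert t E) := by
    rw [hEdef, insert_erase (mem_erase.2 ⟨hst.symm, ht⟩), insert_erase hs]
  have hpushe : push π E e = T := by
    rw [push, huve, image_insert, image_singleton, hπu, hπv, hTE]
    ext x
    simp
  have hpushn : ∀ W ⊆ groundSet n, push π E W ⊆ groundSet n := by
    intro W hW
    refine union_subset (fun x hx => ?_) (hET.trans hT)
    obtain ⟨y, hy, rfl⟩ := mem_image.1 hx
    exact hπn y (hW hy)
  have hpushcard : ∀ W ∈ 𝓐, Disjoint W E → 3 ≤ (push π E W).card := by
    intro W hW hWE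
    rw [push, card_union_of_disjoint, card_image_of_injective _ π.injective]
    · have := h𝓐2 W hW
      have : 0 < E.card := card_pos.2 ⟨ε, hεE⟩
      omega
    · rw [Finset.disjoint_left]
      intro x hx hxE
      obtain ⟨y, hy, rfl⟩ := mem_image.1 hx
      have := hEπ _ hxE
      rw [hππ] at this
      exact Finset.disjoint_left.1 hWE hy (this ▸ hxE)
  have hpushmem : ∀ W ∈ 𝓐, Disjoint W E → W ≠ e → push π E W ∈ 𝓐 := by
    intro W hW hWE hWe
    by_contra hmiss
    have hWn := hpushn W (mem_allFams.1 (hopt.1 hW))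
    have hd := hopt.disjoint_of_notMem hp0 hp1 hn2 hM he he2 hWn (hpushcard W hW hWE) hmiss
    have hmemπ : ∀ {x}, x ∈ W → π x ∈ push π E W := fun hx =>
      mem_union_left _ (mem_image_of_mem _ hx)
    have hsW : s ∉ W := fun h => Finset.disjoint_left.1 hd hu (hπs ▸ hmemπ h)
    have htW : t ∉ W := fun h => Finset.disjoint_left.1 hd hv (hπt ▸ hmemπ h)
    have hεW : ε ∉ W := fun h => Finset.disjoint_left.1 hWE h hεE
    have hother : ∀ x ∈ W, x ≠ u → x ≠ v → x ∈ push π E W := by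
      intro x hx h1 h2
      have := hmemπ hx
      rwa [hπx x h1 h2 (ne_of_mem_of_not_mem hx hsW) (ne_of_mem_of_not_mem hx htW)] at this
    have hεp : ε ∈ push π E W := mem_union_right _ hεE
    by_cases huW : u ∈ W <;> by_cases hvW : v ∈ W
    · have hTsub : T ⊆ push π E W := by
        rw [hTE, insert_subset_iff, insert_subset_iff]
        exact ⟨hπu ▸ hmemπ huW, hπv ▸ hmemπ hvW, subset_union_right⟩
      have hTeq : T = push π E W := eq_of_subset_of_card_le hTsub
        (hTmax _ (mem_filter.2 ⟨mem_sdiff.2 ⟨mem_allFams.2 hWn, hmiss⟩, hpushcard W hW hWE⟩))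
      exact hWe (push_injOn hππ hEπ hWE (heT.mono_right hET) (hTeq.symm.trans hpushe.symm))
    · refine hmiss (hup (hopt.replace_mem hp0 hp1 hn2 hM hW huW hsW hεW hsε (hT hs) (hT hε)) ?_ hWn)
      rw [insert_subset_iff, insert_subset_iff]
      refine ⟨hπu ▸ hmemπ huW, hεp, fun x hx => ?_⟩
      rw [mem_erase] at hx
      exact hother x hx.2 hx.1 (ne_of_mem_of_not_mem hx.2 hvW)
    · refine hmiss (hup (hopt.replace_mem hp0 hp1 hn2 hM hW hvW htW hεW htε (hT ht) (hT hε)) ?_ hWn)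
      rw [insert_subset_iff, insert_subset_iff]
      refine ⟨hπv ▸ hmemπ hvW, hεp, fun x hx => ?_⟩
      rw [mem_erase] at hx
      exact hother x hx.2 (ne_of_mem_of_not_mem hx.2 huW) hx.1
    · exact hmiss (hup hW (fun x hx => hother x hx (ne_of_mem_of_not_mem hx huW)
        (ne_of_mem_of_not_mem hx hvW)) hWn)
  obtain ⟨X, hX, hεX, hXD⟩ : ∃ X ∈ 𝓐, ε ∈ X ∧ Disjoint X {u, v, s, t} := by
    refine exists_mem_disjoint (hT hε) ?_ ?_ ?_
    · simp [insert_subset_iff, hen hu, hen hv, hT hs, hT ht]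
    · simp [(hne hu hε).symm, (hne hv hε).symm, hsε.symm, htε.symm]
    · refine lt_of_pow_lt_pow_left₀ 2 (by positivity) (hM.trans_le ?_)
      rw [← pow_mul]
      have : ({u, v, s, t} : Finset ℕ).card ≤ 4 := card_le_four
      exact Nat.pow_le_pow_right (by norm_num) (by omega)
  simp only [disjoint_insert_right, disjoint_singleton_right] at hXD
  obtain ⟨huX, hvX, hsX, htX⟩ := hXD
  have hXe : Disjoint X e := by
    rw [huve, disjoint_insert_right, disjoint_singleton_right]
    exact ⟨huX, hvX⟩
  refine hopt.false_of_push hp0 hp1 (π := π) (E := E) (𝓚 := {e})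
    (𝓛 := 𝓐.filter fun W => Disjoint W E) (X := X) (Y := e) hππ ⟨ε, hεE⟩ hEπ ?_
    (filter_subset _ _) ?_ ?_ ?_ ?_ ?_ (mem_singleton_self _) ?_ hXe ?_ ?_
  · rw [singleton_subset_iff, mem_filter]
    exact ⟨he, heT.mono_right hET⟩
  · exact fun W hW => (mem_filter.1 hW).2
  · intro W hW
    rwa [mem_singleton.1 hW, hpushe]
  · intro W hW
    rwa [mem_singleton.1 hW, hpushe]
  · intro W hW hWe
    rw [mem_filter] at hW
    rw [mem_singleton] at hWe
    refine mem_sdiff.2 ⟨hpushmem W hW.1 hW.2 hWe, fun h => ?_⟩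
    have := hpushcard W hW.1 hW.2
    rw [mem_singleton.1 h] at this
    omega
  · intro W _ W' hW' _ h
    exact mem_filter.2 ⟨hW', h.mono_right subset_union_right⟩
  · refine mem_sdiff.2 ⟨hX, fun h => huX ?_⟩
    rwa [mem_singleton.1 h]
  · rw [hpushe]
    exact ⟨ε, mem_inter.2 ⟨hεX, hε⟩⟩
  · intro _
    rw [Finset.disjoint_left]
    intro x hx
    obtain ⟨y, hy, rfl⟩ := mem_image.1 hx
    have hyX := (mem_sdiff.1 hy).1
    rw [hπx y (ne_of_mem_of_not_mem hyX huX) (ne_of_mem_of_not_mem hyX hvX)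
      (ne_of_mem_of_not_mem hyX hsX) (ne_of_mem_of_not_mem hyX htX)]
    exact Finset.disjoint_left.1 hXe hyX

/-- An optimal family with `n.choose 2 + 2` missing sets consists of all sets of size at least
three and of a graph. -/
theorem IsOptimal.exists_eq_union (hopt : IsOptimal n p 𝓐) (hp0 : 0 < p) (hp1 : p < 1)
    (hn : 21 ≤ n) (hM : (allFams n \ 𝓐).card ^ 2 < 2 ^ (n - 2))
    (hmiss : (allFams n \ 𝓐).card = n.choose 2 + 2) :
    ∃ 𝓗 ⊆ layerEQ n 2, 𝓐 = layerGE n 3 ∪ 𝓗 := by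
  have h𝓐2 := fun Y hY => hopt.two_le_card hp0 hp1 hn hM hmiss (Y := Y) hY
  obtain ⟨e, he, he2⟩ : ∃ e ∈ 𝓐, e.card = 2 := by
    by_contra! hcon
    have hsub : layerEQ n 2 ∪ layerEQ n 1 ⊆ allFams n \ 𝓐 := by
      intro Y hY
      simp only [layerEQ, mem_union, mem_powersetCard] at hY
      rw [mem_sdiff, mem_allFams]
      rcases hY with h | h
      · exact ⟨h.1, fun h' => hcon Y h' h.2⟩
      · refine ⟨h.1, fun h' => ?_⟩
        have := h𝓐2 Y h'
        omega
    have hdisj : Disjoint (layerEQ n 2) (layerEQ n 1) :=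
      pairwise_disjoint_powersetCard _ (by norm_num)
    have := card_le_card hsub
    rw [card_union_of_disjoint hdisj, layerEQ, layerEQ, card_powersetCard, card_powersetCard,
      card_groundSet, Nat.choose_one_right] at this
    omega
  refine ⟨𝓐.filter fun Y => Y.card = 2, fun Y hY => ?_, ?_⟩
  · rw [mem_filter] at hY
    exact mem_powersetCard.2 ⟨mem_allFams.1 (hopt.1 hY.1), hY.2⟩
  · ext Y
    simp only [layerGE, mem_union, mem_filter]
    constructor
    · intro hY
      have := h𝓐2 Y hY
      by_cases h : Y.card = 2
      · exact Or.inr ⟨hY, h⟩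
      · exact Or.inl ⟨hopt.1 hY, by omega⟩
    · rintro (h | h)
      · exact hopt.mem_of_three_le_card hp0 hp1 (by omega) hM h𝓐2 he he2 (mem_allFams.1 h.1) h.2
      · exact h.1

end Optimal

/-- The edges of the complete graph on `[n]` which contain `c`. -/
def starGraph (n c : ℕ) : Finset (Finset ℕ) := (layerEQ n 2).filter fun A => c ∈ A

theorem mem_starGraph {n c : ℕ} {A : Finset ℕ} :
    A ∈ starGraph n c ↔ A ⊆ groundSet n ∧ A.card = 2 ∧ c ∈ A := by
  simp [starGraph, layerEQ, and_assoc]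

theorem starGraph_subset (n c : ℕ) : starGraph n c ⊆ layerEQ n 2 := filter_subset _ _

theorem mem_layerGE {n r : ℕ} {A : Finset ℕ} :
    A ∈ layerGE n r ↔ A ⊆ groundSet n ∧ r ≤ A.card := by
  simp [layerGE, mem_allFams]

theorem eq_pair_of_mem {f : Finset ℕ} {x y : ℕ} (hf : f.card = 2) (hx : x ∈ f) (hy : y ∈ f)
    (hxy : x ≠ y) : f = {x, y} :=
  (eq_of_subset_of_card_le (insert_subset hx (singleton_subset_iff.2 hy))
    (by rw [hf, card_pair hxy])).symm

theorem card_starGraph {n c : ℕ} (hc : c ∈ groundSet n) : (starGraph n c).card = n - 1 := by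
  have h : starGraph n c = ((groundSet n).erase c).image fun x => {c, x} := by
    ext A
    rw [mem_starGraph, mem_image]
    constructor
    · rintro ⟨h1, h2, h3⟩
      obtain ⟨x, hx, hxc⟩ := exists_mem_ne (by omega : 1 < A.card) c
      exact ⟨x, mem_erase.2 ⟨hxc, h1 hx⟩, (eq_pair_of_mem h2 h3 hx hxc.symm).symm⟩
    · rintro ⟨x, hx, rfl⟩
      rw [mem_erase] at hx
      exact ⟨insert_subset hc (singleton_subset_iff.2 hx.2), card_pair hx.1.symm,
        mem_insert_self _ _⟩
  rw [h, card_image_of_injOn, card_erase_of_mem hc, card_groundSet]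
  intro x hx y hy hxy
  have h1 : x ∈ ({c, y} : Finset ℕ) := by
    rw [← show ({c, x} : Finset ℕ) = {c, y} from hxy]
    simp
  rcases mem_insert.1 h1 with h2 | h2
  · exact absurd h2 (mem_erase.1 hx).1
  · exact mem_singleton.1 h2

/-- An intersecting family of pairs is a star or a triangle. -/
theorem exists_common_or_triangle {n : ℕ} (hn : 1 ≤ n) {F : Finset (Finset ℕ)}
    (hF : F ⊆ layerEQ n 2) (hFi : IsInter F) :
    (∃ c ∈ groundSet n, ∀ f ∈ F, c ∈ f) ∨
      ∃ a b c, a ≠ b ∧ b ≠ c ∧ a ≠ c ∧ F = {{a, b}, {b, c}, {a, c}} := by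
  by_cases hcom : ∃ c ∈ groundSet n, ∀ f ∈ F, c ∈ f
  · exact Or.inl hcom
  right
  push Not at hcom
  have hF' : ∀ f ∈ F, f ⊆ groundSet n ∧ f.card = 2 := fun f hf => mem_powersetCard.1 (hF hf)
  obtain ⟨e, he, -⟩ := hcom 1 (by simp [groundSet, hn])
  obtain ⟨a, b, hab, rfl⟩ := card_eq_two.1 (hF' e he).2
  obtain ⟨f, hf, haf⟩ := hcom a ((hF' _ he).1 (by simp))
  have hbf : b ∈ f := by
    obtain ⟨x, hx⟩ := hFi _ he _ hf
    simp only [mem_inter, mem_insert, mem_singleton] at hx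
    rcases hx with ⟨rfl | rfl, hx⟩
    · exact absurd hx haf
    · exact hx
  obtain ⟨c, hcf, hcb⟩ := exists_mem_ne (by rw [(hF' f hf).2]; norm_num : 1 < f.card) b
  have hac : a ≠ c := fun h => haf (h ▸ hcf)
  obtain rfl := eq_pair_of_mem (hF' f hf).2 hbf hcf hcb.symm
  obtain ⟨g, hg, hbg⟩ := hcom b ((hF' _ he).1 (by simp))
  have hag : a ∈ g := by
    obtain ⟨x, hx⟩ := hFi _ he _ hg
    simp only [mem_inter, mem_insert, mem_singleton] at hx
    rcases hx with ⟨rfl | rfl, hx⟩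
    · exact hx
    · exact absurd hx hbg
  have hcg : c ∈ g := by
    obtain ⟨x, hx⟩ := hFi _ hf _ hg
    simp only [mem_inter, mem_insert, mem_singleton] at hx
    rcases hx with ⟨rfl | rfl, hx⟩
    · exact absurd hx hbg
    · exact hx
  obtain rfl := eq_pair_of_mem (hF' g hg).2 hag hcg hac
  refine ⟨a, b, c, hab, hcb.symm, hac, Subset.antisymm (fun h hh => ?_) ?_⟩
  · have h2 := (hF' h hh).2
    obtain ⟨x, hx⟩ := hFi _ he _ hh
    obtain ⟨y, hy⟩ := hFi _ hf _ hh
    obtain ⟨z, hz⟩ := hFi _ hg _ hh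
    simp only [mem_inter, mem_insert, mem_singleton] at hx hy hz ⊢
    by_cases ha : a ∈ h
    · by_cases hb : b ∈ h
      · exact Or.inl (eq_pair_of_mem h2 ha hb hab)
      · refine Or.inr (Or.inr (eq_pair_of_mem h2 ha ?_ hac))
        rcases hy with ⟨rfl | rfl, hy⟩
        · exact absurd hy hb
        · exact hy
    · refine Or.inr (Or.inl (eq_pair_of_mem h2 ?_ ?_ hcb.symm))
      · rcases hx with ⟨rfl | rfl, hx⟩
        · exact absurd hx ha
        · exact hx
      · rcases hz with ⟨rfl | rfl, hz⟩
        · exact absurd hz ha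
        · exact hz
  · simp [insert_subset_iff, he, hf, hg]

theorem exists_injOn_extend {n : ℕ} {s : Finset ℕ} (hs : s ⊆ groundSet n) {τ : ℕ → ℕ}
    (hτ : ∀ x ∈ s, τ x ∈ groundSet n) (hinj : Set.InjOn τ s) :
    ∃ σ : ℕ → ℕ, (∀ x ∈ groundSet n, σ x ∈ groundSet n) ∧ Set.InjOn σ (groundSet n) ∧
      ∀ x ∈ s, σ x = τ x := by
  classical
  obtain ⟨g, hg⟩ := Finset.exists_equiv_extend_of_card_eq (α := groundSet n) (t := groundSet n)
    (by simp) (s := univ.filter fun x => (x : ℕ) ∈ s) (f := fun x => τ x)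
    (fun y hy => by
      obtain ⟨x, hx, rfl⟩ := mem_image.1 hy
      exact hτ _ (mem_filter.1 hx).2)
    (fun x hx y hy h => Subtype.ext (hinj (by simpa using hx) (by simpa using hy) h))
  refine ⟨fun x => if h : x ∈ groundSet n then g ⟨x, h⟩ else 0, fun x hx => ?_,
    fun x hx y hy h => ?_, fun x hx => ?_⟩
  · simp only [hx, dif_pos]
    exact (g ⟨x, hx⟩).2
  · rw [mem_coe] at hx hy
    simp only [hx, hy, dif_pos] at h
    exact congrArg Subtype.val (g.injective (Subtype.ext h))
  · simp only [hs hx, dif_pos]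
    exact hg ⟨x, hs hx⟩ (by simpa using hx)

/-- The sets of size at least three meeting every edge of a triangle inject into a family of
pairwise meeting sets of size at least three which meet every edge of a star with three edges. -/
theorem exists_triangle_transfer {n a p q r : ℕ} (hn : 6 ≤ n) (ha : a ∈ groundSet n)
    (hp : p ∈ groundSet n) (hq : q ∈ groundSet n) (hr : r ∈ groundSet n) (hap : a ≠ p)
    (haq : a ≠ q) (har : a ≠ r) (hpq : p ≠ q) :
    ∃ χ inv : Finset ℕ → Finset ℕ, ∀ y ⊆ groundSet n, 3 ≤ y.card → (a ∈ y ∨ p ∈ y) →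
      (p ∈ y ∨ q ∈ y) → (a ∈ y ∨ q ∈ y) → inv (χ y) = y ∧ χ y ⊆ groundSet n ∧ 3 ≤ (χ y).card ∧
        (a ∈ χ y ∨ p ∈ χ y ∧ q ∈ χ y ∧ r ∈ χ y ∧ (groundSet n \ χ y).card ≤ 2) := by
  have hG := card_groundSet n
  set G := groundSet n with hGdef
  have hsub : ∀ {x y}, x ∈ G → y ∈ G → ({x, y} : Finset ℕ) ⊆ G := fun hx hy =>
    insert_subset hx (singleton_subset_iff.2 hy)
  refine ⟨fun y => if a ∈ y then y else if 3 ≤ (G \ y).card then G \ y else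
    if y = G \ {a, r} then G \ {p, q} else y,
    fun z => if a ∉ z then z else if p ∈ z ∨ q ∈ z then z else
      if z = G \ {p, q} then G \ {a, r} else G \ z, ?_⟩
  intro y hy hy3 h1 h2 h3
  by_cases hay : a ∈ y
  · simp [hay, h2, hy, hy3]
  have hpy : p ∈ y := h1.resolve_left hay
  have hqy : q ∈ y := h3.resolve_left hay
  by_cases hc : 3 ≤ (G \ y).card
  · have hne : G \ y ≠ G \ {p, q} := by
      intro h
      have : y = {p, q} := by
        rw [← Finset.sdiff_sdiff_eq_self hy, h, Finset.sdiff_sdiff_eq_self (hsub hp hq)]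
      rw [this, card_pair hpq] at hy3
      omega
    simp [hay, hc, ha, hpy, hqy, hne, hy]
  by_cases hyr : y = G \ {a, r}
  · have hcard : (G \ {p, q}).card = n - 2 := by
      rw [card_sdiff_of_subset (hsub hp hq), hG, card_pair hpq]
    have hpz : p ∉ G \ {p, q} := by simp
    have hqz : q ∉ G \ {p, q} := by simp
    have haz : a ∈ G \ {p, q} := by simp [ha, hap, haq]
    beta_reduce
    rw [if_neg hay, if_neg hc, if_pos hyr]
    refine ⟨?_, sdiff_subset, by omega, Or.inl haz⟩
    rw [if_neg (not_not_intro haz), if_neg (not_or_intro hpz hqz), if_pos rfl, hyr]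
  · have hrny : r ∈ y := by
      by_contra hry
      refine hyr ?_
      rw [eq_of_subset_of_card_le (insert_subset (mem_sdiff.2 ⟨ha, hay⟩)
        (singleton_subset_iff.2 (mem_sdiff.2 ⟨hr, hry⟩))) (by rw [card_pair har]; omega), Finset.sdiff_sdiff_eq_self hy]
    simp [hay, hc, hyr, hy, hy3, hpy, hqy, hrny]
    omega

/-- The sets of size at least three which meet every member of an intersecting graph `F` can be
transferred to sets which meet every edge of a star with `F.card` edges. -/
theorem exists_transfer {n : ℕ} (hn : 6 ≤ n) {F : Finset (Finset ℕ)} (hF : F ⊆ layerEQ n 2)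
    (hFi : IsInter F) {l : Finset ℕ → ℕ} (hl : ∀ f ∈ F, l f ∈ groundSet n ∧ l f ≠ 1)
    (hlinj : Set.InjOn l F) :
    ∃ ψ : Finset ℕ → Finset ℕ,
      (∀ d ∈ layerGE n 3, (∀ f ∈ F, (d ∩ f).Nonempty) →
        ψ d ∈ layerGE n 3 ∧ ∀ f ∈ F, (ψ d ∩ {1, l f}).Nonempty) ∧
      (∀ d ∈ layerGE n 3, (∀ f ∈ F, (d ∩ f).Nonempty) →
        ∀ d' ∈ layerGE n 3, (∀ f ∈ F, (d' ∩ f).Nonempty) →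
          (ψ d = ψ d' → d = d') ∧ ((d ∩ d').Nonempty → (ψ d ∩ ψ d').Nonempty)) := by
  have h1G : 1 ∈ groundSet n := by
    simp only [groundSet, mem_Icc]
    omega
  have hF' : ∀ f ∈ F, f ⊆ groundSet n ∧ f.card = 2 := fun f hf => mem_powersetCard.1 (hF hf)
  have himage : ∀ {σ : ℕ → ℕ}, (∀ x ∈ groundSet n, σ x ∈ groundSet n) →
      Set.InjOn σ (groundSet n) → ∀ d ∈ layerGE n 3, d.image σ ∈ layerGE n 3 := by
    intro σ hσ hσi d hd
    rw [mem_layerGE] at hd ⊢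
    rw [card_image_of_injOn (hσi.mono (coe_subset.2 hd.1))]
    exact ⟨fun x hx => by
      obtain ⟨y, hy, rfl⟩ := mem_image.1 hx
      exact hσ y (hd.1 hy), hd.2⟩
  have himage_inj : ∀ {σ : ℕ → ℕ}, Set.InjOn σ (groundSet n) → ∀ d ∈ layerGE n 3,
      ∀ d' ∈ layerGE n 3, d.image σ = d'.image σ → d = d' := by
    intro σ hσi d hd d' hd' h
    rw [← coe_inj, coe_image, coe_image, hσi.image_eq_image_iff
      (coe_subset.2 (mem_layerGE.1 hd).1) (coe_subset.2 (mem_layerGE.1 hd').1)] at h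
    exact coe_inj.1 h
  rcases exists_common_or_triangle (by omega) hF hFi with ⟨c, hc, hcF⟩ |
    ⟨a, b, c, hab, hbc, hac, rfl⟩
  · have hpair : ∀ f ∈ F, ∀ x ∈ f, x ≠ c → {c, x} = f := fun f hf x hx hxc =>
      (eq_pair_of_mem (hF' f hf).2 (hcF f hf) hx hxc.symm).symm
    have hmem : ∀ {x}, x ∈ F.biUnion id → ∃ f ∈ F, x ∈ f := fun hx => by simpa using hx
    obtain ⟨σ, hσ, hσi, hστ⟩ := exists_injOn_extend (n := n) (s := insert c (F.biUnion id))
      (τ := fun x => if x = c then 1 else l {c, x})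
      (insert_subset hc (biUnion_subset.2 fun f hf => (hF' f hf).1))
      (fun x hx => by
        by_cases hxc : x = c
        · simpa [hxc] using h1G
        · obtain ⟨f, hf, hxf⟩ := hmem ((mem_insert.1 hx).resolve_left hxc)
          simp only [hxc, if_false, hpair f hf x hxf hxc]
          exact (hl f hf).1)
      (fun x hx y hy h => by
        rw [mem_coe] at hx hy
        by_cases hxc : x = c <;> by_cases hyc : y = c
        · rw [hxc, hyc]
        · obtain ⟨f, hf, hyf⟩ := hmem ((mem_insert.1 hy).resolve_left hyc)
          simp only [hxc, hyc, if_false, if_true, hpair f hf y hyf hyc] at h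
          exact absurd h.symm (hl f hf).2
        · obtain ⟨f, hf, hxf⟩ := hmem ((mem_insert.1 hx).resolve_left hxc)
          simp only [hxc, hyc, if_false, if_true, hpair f hf x hxf hxc] at h
          exact absurd h (hl f hf).2
        · obtain ⟨f, hf, hxf⟩ := hmem ((mem_insert.1 hx).resolve_left hxc)
          obtain ⟨g, hg, hyg⟩ := hmem ((mem_insert.1 hy).resolve_left hyc)
          simp only [hxc, hyc, if_false, hpair f hf x hxf hxc, hpair g hg y hyg hyc] at h
          have hfg := hlinj hf hg h
          rw [← hfg, ← hpair f hf x hxf hxc] at hyg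
          rcases mem_insert.1 hyg with h' | h'
          · exact absurd h' hyc
          · exact (mem_singleton.1 h').symm)
    refine ⟨fun d => d.image σ, fun d hd hdF => ⟨himage hσ hσi d hd, fun f hf => ?_⟩,
      fun d hd _ d' hd' _ => ⟨himage_inj hσi d hd d' hd', ?_⟩⟩
    · obtain ⟨x, hx⟩ := hdF f hf
      rw [mem_inter] at hx
      refine ⟨σ x, mem_inter.2 ⟨mem_image_of_mem _ hx.1, ?_⟩⟩
      rw [hστ x (mem_insert_of_mem (mem_biUnion.2 ⟨f, hf, hx.2⟩))]
      by_cases hxc : x = c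
      · simp [hxc]
      · simp [hxc, hpair f hf x hx.2 hxc]
    · rintro ⟨x, hx⟩
      rw [mem_inter] at hx
      exact ⟨σ x, mem_inter.2 ⟨mem_image_of_mem _ hx.1, mem_image_of_mem _ hx.2⟩⟩
  · have hFab : ({a, b} : Finset ℕ) ∈ ({{a, b}, {b, c}, {a, c}} : Finset (Finset ℕ)) := by simp
    have hFbc : ({b, c} : Finset ℕ) ∈ ({{a, b}, {b, c}, {a, c}} : Finset (Finset ℕ)) := by simp
    have hFac : ({a, c} : Finset ℕ) ∈ ({{a, b}, {b, c}, {a, c}} : Finset (Finset ℕ)) := by simp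
    have haG := (hF' _ hFab).1 (mem_insert_self a _)
    have hbG := (hF' _ hFbc).1 (mem_insert_self b _)
    have hcG : c ∈ groundSet n := (hF' _ hFbc).1 (by simp)
    have hl1 : l {a, b} ≠ l {b, c} := fun h => by
      have := hlinj hFab hFbc h
      have h' : a ∈ ({b, c} : Finset ℕ) := this ▸ mem_insert_self a _
      simp [hab, hac] at h'
    obtain ⟨σ, hσ, hσi, hστ⟩ := exists_injOn_extend (n := n) (s := {a, b, c})
      (τ := fun x => if x = a then 1 else if x = b then l {a, b} else l {b, c})
      (by simp [insert_subset_iff, haG, hbG, hcG])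
      (fun x hx => by
        split_ifs
        · exact h1G
        · exact (hl _ hFab).1
        · exact (hl _ hFbc).1)
      (fun x hx y hy h => by
        have h1 := (hl _ hFab).2
        have h2 := (hl _ hFbc).2
        generalize l {a, b} = u at h h1 h2 hl1
        generalize l {b, c} = v at h h1 h2 hl1
        simp only [coe_insert, coe_singleton, Set.mem_insert_iff, Set.mem_singleton_iff] at hx hy
        clear * - hx hy h h1 h2 hl1 hab hbc hac
        grind)
    have hσa : σ a = 1 := by simp [hστ a (by simp)]
    have hσb : σ b = l {a, b} := by simp [hστ b (by simp), hab.symm]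
    have hσc : σ c = l {b, c} := by simp [hστ c (by simp), hac.symm, hbc.symm]
    obtain ⟨χ, inv, hχ⟩ := exists_triangle_transfer hn h1G (hl _ hFab).1 (hl _ hFbc).1
      (hl _ hFac).1 (hl _ hFab).2.symm (hl _ hFbc).2.symm (hl _ hFac).2.symm hl1
    have hmeet : ∀ {d : Finset ℕ} {x y}, (d ∩ {x, y}).Nonempty →
        σ x ∈ d.image σ ∨ σ y ∈ d.image σ := by
      rintro d x y ⟨z, hz⟩
      simp only [mem_inter, mem_insert, mem_singleton] at hz
      rcases hz with ⟨hz, rfl | rfl⟩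
      · exact Or.inl (mem_image_of_mem _ hz)
      · exact Or.inr (mem_image_of_mem _ hz)
    have hχ' : ∀ d ∈ layerGE n 3, (∀ f ∈ ({{a, b}, {b, c}, {a, c}} : Finset (Finset ℕ)),
        (d ∩ f).Nonempty) → _ := fun d hd hdF =>
      hχ (d.image σ) (mem_layerGE.1 (himage hσ hσi d hd)).1 (mem_layerGE.1 (himage hσ hσi d hd)).2
        (by rw [← hσa, ← hσb]; exact hmeet (hdF _ hFab))
        (by rw [← hσb, ← hσc]; exact hmeet (hdF _ hFbc))
        (by rw [← hσa, ← hσc]; exact hmeet (hdF _ hFac))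
    have hmeet1 : ∀ {y z : Finset ℕ}, y ⊆ groundSet n → 3 ≤ y.card →
        (groundSet n \ z).card ≤ 2 → (y ∩ z).Nonempty := by
      intro y z hy hy3 hz
      rw [← not_disjoint_iff_nonempty_inter]
      intro h
      have := card_le_card (subset_sdiff.2 ⟨hy, h⟩)
      omega
    refine ⟨fun d => χ (d.image σ), fun d hd hdF => ?_, fun d hd hdF d' hd' hdF' => ⟨?_, ?_⟩⟩
    · obtain ⟨-, h1, h2, h3⟩ := hχ' d hd hdF
      refine ⟨mem_layerGE.2 ⟨h1, h2⟩, fun f hf => ?_⟩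
      rcases h3 with h3 | ⟨h3, h4, h5, -⟩
      · exact ⟨1, mem_inter.2 ⟨h3, mem_insert_self _ _⟩⟩
      · refine ⟨l f, mem_inter.2 ⟨?_, by simp⟩⟩
        simp only [mem_insert, mem_singleton] at hf
        rcases hf with rfl | rfl | rfl <;> assumption
    · intro h
      refine himage_inj hσi d hd d' hd' ?_
      rw [← (hχ' d hd hdF).1, ← (hχ' d' hd' hdF').1]
      exact congrArg inv h
    · intro _
      obtain ⟨-, h1, h2, h3⟩ := hχ' d hd hdF
      obtain ⟨-, h1', h2', h3'⟩ := hχ' d' hd' hdF'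
      rcases h3 with h3 | ⟨h3, -, -, h4⟩
      · rcases h3' with h3' | ⟨h3', -, -, h4'⟩
        · exact ⟨1, mem_inter.2 ⟨h3, h3'⟩⟩
        · exact hmeet1 h1 h2 h4'
      · rw [inter_comm]
        exact hmeet1 h1' h2' h4

theorem disjoint_layerGE_layerEQ (n : ℕ) : Disjoint (layerGE n 3) (layerEQ n 2) := by
  rw [disjoint_left]
  intro A h h'
  have h1 := (mem_layerGE.1 h).2
  have h2 := (mem_powersetCard.1 h').2
  omega

theorem card_layerGE_union {n : ℕ} {𝓗 : Finset (Finset ℕ)} (h𝓗 : 𝓗 ⊆ layerEQ n 2) :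
    (layerGE n 3 ∪ 𝓗).card = (layerGE n 3).card + 𝓗.card :=
  card_union_of_disjoint ((disjoint_layerGE_layerEQ n).mono_right h𝓗)

/-- If `n - 1` edges do not form an intersecting family, then replacing them by a star increases the
probability of being intersecting. -/
theorem probInter_lt_starGraph {n : ℕ} (hn : 6 ≤ n) {p : ℝ} (hp0 : 0 < p) (hp1 : p < 1)
    {𝓗 : Finset (Finset ℕ)} (h𝓗 : 𝓗 ⊆ layerEQ n 2) (hcard : 𝓗.card = n - 1) {e₁ e₂ : Finset ℕ}
    (he₁ : e₁ ∈ 𝓗) (he₂ : e₂ ∈ 𝓗) (he : ¬ (e₁ ∩ e₂).Nonempty) :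
    probInter p (layerGE n 3 ∪ 𝓗) < probInter p (layerGE n 3 ∪ starGraph n 1) := by
  have h1G : 1 ∈ groundSet n := by
    simp only [groundSet, mem_Icc]
    omega
  have hstar := starGraph_subset n 1
  obtain ⟨l, hl, hlinj⟩ : ∃ l : Finset ℕ → ℕ, (∀ f ∈ 𝓗, l f ∈ groundSet n ∧ l f ≠ 1) ∧
      Set.InjOn l 𝓗 := by
    let g := Finset.equivOfCardEq (s := 𝓗) (t := (groundSet n).erase 1)
      (by rw [hcard, card_erase_of_mem h1G, card_groundSet])
    refine ⟨fun f => if h : f ∈ 𝓗 then g ⟨f, h⟩ else 0, fun f hf => ?_, fun f hf f' hf' h => ?_⟩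
    · have := mem_erase.1 (g ⟨f, hf⟩).2
      simpa only [hf, dif_pos] using this.symm
    · rw [mem_coe] at hf hf'
      simp only [hf, hf', dif_pos] at h
      exact congrArg Subtype.val (g.injective (Subtype.ext h))
  have hφ : ∀ f ∈ 𝓗, ({1, l f} : Finset ℕ) ∈ starGraph n 1 := fun f hf =>
    mem_starGraph.2 ⟨insert_subset h1G (singleton_subset_iff.2 (hl f hf).1),
      card_pair (hl f hf).2.symm, mem_insert_self _ _⟩
  have hφinj : Set.InjOn (fun f => ({1, l f} : Finset ℕ)) 𝓗 := by
    intro f hf f' hf' h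
    have h1 : l f ∈ ({1, l f'} : Finset ℕ) := by
      rw [← show ({1, l f} : Finset ℕ) = {1, l f'} from h]
      simp
    exact hlinj hf hf' (mem_singleton.1 ((mem_insert.1 h1).resolve_left (hl f hf).2))
  have hex : ∀ F : Finset (Finset ℕ), ∃ ψ : Finset ℕ → Finset ℕ, F ⊆ 𝓗 → IsInter F →
      (∀ d ∈ layerGE n 3, (∀ f ∈ F, (d ∩ f).Nonempty) →
        ψ d ∈ layerGE n 3 ∧ ∀ f ∈ F, (ψ d ∩ {1, l f}).Nonempty) ∧
      (∀ d ∈ layerGE n 3, (∀ f ∈ F, (d ∩ f).Nonempty) →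
        ∀ d' ∈ layerGE n 3, (∀ f ∈ F, (d' ∩ f).Nonempty) →
          (ψ d = ψ d' → d = d') ∧ ((d ∩ d').Nonempty → (ψ d ∩ ψ d').Nonempty)) := by
    intro F
    by_cases hF : F ⊆ 𝓗 ∧ IsInter F
    · obtain ⟨ψ, hψ⟩ := exists_transfer hn (hF.1.trans h𝓗) hF.2 (fun f hf => hl f (hF.1 hf))
        (hlinj.mono (coe_subset.2 hF.1))
      exact ⟨ψ, fun _ _ => hψ⟩
    · exact ⟨id, fun h1 h2 => absurd ⟨h1, h2⟩ hF⟩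
  choose Ψ hΨ using hex
  set φ : Finset ℕ → Finset ℕ := fun f => {1, l f} with hφdef
  set S : Finset (Finset ℕ) → Finset (Finset ℕ) := fun 𝓑 => (𝓑 ∩ 𝓗).image φ ∪
    (𝓑 ∩ layerGE n 3).image (Ψ (𝓑 ∩ 𝓗)) with hS
  have hi : ∀ {𝓑}, IsInter 𝓑 → IsInter (𝓑 ∩ 𝓗) := fun h B hB B' hB' =>
    h B (mem_inter.1 hB).1 B' (mem_inter.1 hB').1
  have hd : ∀ {𝓑}, IsInter 𝓑 → ∀ d ∈ 𝓑, ∀ f ∈ 𝓑 ∩ 𝓗, (d ∩ f).Nonempty := fun h d hd f hf =>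
    h d hd f (mem_inter.1 hf).1
  have hΨ1 : ∀ {𝓑}, IsInter 𝓑 → ∀ d ∈ 𝓑, d ∈ layerGE n 3 →
      Ψ (𝓑 ∩ 𝓗) d ∈ layerGE n 3 ∧ ∀ f ∈ 𝓑 ∩ 𝓗, (Ψ (𝓑 ∩ 𝓗) d ∩ φ f).Nonempty := fun h d hd1 hd2 =>
    (hΨ _ inter_subset_right (hi h)).1 d hd2 (hd h d hd1)
  have hne : ∀ {A B}, A ∈ starGraph n 1 → B ∈ layerGE n 3 → A ≠ B := fun hA hB h =>
    disjoint_left.1 (disjoint_layerGE_layerEQ n) hB (h ▸ hstar hA)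
  have hSφ : ∀ {𝓑}, IsInter 𝓑 → ∀ f ∈ 𝓗, φ f ∈ S 𝓑 → f ∈ 𝓑 := by
    intro 𝓑 h f hf hfS
    rcases mem_union.1 hfS with hfS | hfS
    · obtain ⟨f', hf', h'⟩ := mem_image.1 hfS
      rw [mem_inter] at hf'
      rw [← hφinj hf'.2 hf h']
      exact hf'.1
    · obtain ⟨d, hd1, h'⟩ := mem_image.1 hfS
      rw [mem_inter] at hd1
      exact absurd h'.symm (hne (hφ f hf) (hΨ1 h d hd1.1 hd1.2).1)
  have hSsub : ∀ {𝓑 𝓓}, 𝓑 ⊆ layerGE n 3 ∪ 𝓗 → IsInter 𝓑 → IsInter 𝓓 → 𝓑 ∩ 𝓗 = 𝓓 ∩ 𝓗 →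
      S 𝓑 = S 𝓓 → 𝓑 ⊆ 𝓓 := by
    intro 𝓑 𝓓 h𝓑 h𝓑i h𝓓i hF hBD A hA
    rcases mem_union.1 (h𝓑 hA) with hA1 | hA1
    · have h1 : Ψ (𝓑 ∩ 𝓗) A ∈ S 𝓓 := hBD ▸
        mem_union_right _ (mem_image_of_mem _ (mem_inter.2 ⟨hA, hA1⟩))
      rcases mem_union.1 h1 with h1 | h1
      · obtain ⟨f, hf, h'⟩ := mem_image.1 h1
        exact absurd h' (hne (hφ f (mem_inter.1 hf).2) (hΨ1 h𝓑i A hA hA1).1)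
      · obtain ⟨d, hd1, h'⟩ := mem_image.1 h1
        rw [mem_inter] at hd1
        rw [← hF] at h'
        rw [← ((hΨ _ inter_subset_right (hi h𝓑i)).2 d hd1.2 (hF ▸ hd h𝓓i d hd1.1) A hA1
          (hd h𝓑i A hA)).1 h']
        exact hd1.1
    · exact (mem_inter.1 (hF ▸ mem_inter.2 ⟨hA, hA1⟩ : A ∈ 𝓓 ∩ 𝓗)).1
  refine probInter_lt_of_injOn hp0 hp1 ?_ S ?_ ?_ ?_ ?_ {φ e₁, φ e₂} ?_ ?_ ?_
  · rw [card_layerGE_union h𝓗, card_layerGE_union hstar, card_starGraph h1G, hcard]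
  · intro 𝓑 h𝓑 h𝓑i A hA
    rcases mem_union.1 hA with hA | hA <;> obtain ⟨d, hd1, rfl⟩ := mem_image.1 hA <;>
      rw [mem_inter] at hd1
    · exact mem_union_right _ (hφ d hd1.2)
    · exact mem_union_left _ (hΨ1 h𝓑i d hd1.1 hd1.2).1
  · intro 𝓑 h𝓑 h𝓑i A hA B hB
    rcases mem_union.1 hA with hA | hA <;> obtain ⟨a, ha, rfl⟩ := mem_image.1 hA <;>
      rcases mem_union.1 hB with hB | hB <;> obtain ⟨b, hb, rfl⟩ := mem_image.1 hB
    · exact ⟨1, by simp [hφdef]⟩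
    · rw [inter_comm]
      exact (hΨ1 h𝓑i b (mem_inter.1 hb).1 (mem_inter.1 hb).2).2 a ha
    · exact (hΨ1 h𝓑i a (mem_inter.1 ha).1 (mem_inter.1 ha).2).2 b hb
    · rw [mem_inter] at ha hb
      exact ((hΨ _ inter_subset_right (hi h𝓑i)).2 a ha.2 (hd h𝓑i a ha.1) b hb.2
        (hd h𝓑i b hb.1)).2 (h𝓑i a ha.1 b hb.1)
  · intro 𝓑 h𝓑 h𝓑i
    rw [hS, card_union_of_disjoint, card_image_of_injOn, card_image_of_injOn,
      ← card_union_of_disjoint, ← inter_union_distrib_left, union_comm, inter_eq_left.2 h𝓑]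
    · exact ((disjoint_layerGE_layerEQ n).mono_right h𝓗).symm.mono inter_subset_right
        inter_subset_right
    · intro a ha b hb h
      rw [mem_coe, mem_inter] at ha hb
      exact ((hΨ _ inter_subset_right (hi h𝓑i)).2 a ha.2 (hd h𝓑i a ha.1) b hb.2
        (hd h𝓑i b hb.1)).1 h
    · exact hφinj.mono (coe_subset.2 inter_subset_right)
    · rw [disjoint_left]
      intro A hA hA'
      obtain ⟨f, hf, rfl⟩ := mem_image.1 hA
      obtain ⟨d, hd1, h'⟩ := mem_image.1 hA'
      rw [mem_inter] at hd1
      exact hne (hφ f (mem_inter.1 hf).2) (hΨ1 h𝓑i d hd1.1 hd1.2).1 h'.symm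
  · intro 𝓑 h𝓑 h𝓑i 𝓓 h𝓓 h𝓓i h
    have hF : 𝓑 ∩ 𝓗 = 𝓓 ∩ 𝓗 := by
      ext A
      simp only [mem_inter, and_congr_left_iff]
      intro hA
      constructor
      · intro hA'
        exact hSφ h𝓓i A hA (h ▸ mem_union_left _ (mem_image_of_mem φ (mem_inter.2 ⟨hA', hA⟩)))
      · intro hA'
        exact hSφ h𝓑i A hA (h ▸ mem_union_left _ (mem_image_of_mem φ (mem_inter.2 ⟨hA', hA⟩)))
    exact Subset.antisymm (hSsub h𝓑 h𝓑i h𝓓i hF h) (hSsub h𝓓 h𝓓i h𝓑i hF.symm h.symm)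
  · exact insert_subset (mem_union_right _ (hφ _ he₁))
      (singleton_subset_iff.2 (mem_union_right _ (hφ _ he₂)))
  · intro A hA B hB
    simp only [mem_insert, mem_singleton] at hA hB
    refine ⟨1, ?_⟩
    rcases hA with rfl | rfl <;> rcases hB with rfl | rfl <;> simp [hφdef]
  · intro 𝓑 h𝓑 h𝓑i h
    exact he (h𝓑i _ (hSφ h𝓑i e₁ he₁ (by simp [h])) _ (hSφ h𝓑i e₂ he₂ (by simp [h])))

theorem card_layerGE (n r : ℕ) : (layerGE n r).card = ∑ k ∈ Icc r n, n.choose k := by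
  rw [card_eq_sum_card_fiberwise (f := card) (t := Icc r n)]
  · refine sum_congr rfl fun k hk => ?_
    rw [mem_Icc] at hk
    have h : (layerGE n r).filter (fun A => A.card = k) = layerEQ n k := by
      ext A
      simp only [mem_filter, mem_layerGE, layerEQ, mem_powersetCard]
      constructor
      · exact fun h => ⟨h.1.1, h.2⟩
      · exact fun h => ⟨⟨h.1, h.2 ▸ hk.1⟩, h.2⟩
    rw [h, layerEQ, card_powersetCard, card_groundSet]
  · intro A hA
    rw [mem_coe, mem_layerGE] at hA
    rw [mem_coe, mem_Icc]
    exact ⟨hA.2, (card_le_card hA.1).trans (card_groundSet n).le⟩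

theorem two_pow_eq_sum_Icc_three {n : ℕ} (hn : 2 ≤ n) :
    2 ^ n = (∑ k ∈ Icc 3 n, n.choose k) + (1 + n + n.choose 2) := by
  rw [← Nat.sum_range_choose, ← sum_range_add_sum_Ico _ (by omega : 3 ≤ n + 1), add_comm]
  congr 1
  simp [sum_range_succ]

theorem pow_four_lt_two_pow {n : ℕ} (hn : 21 ≤ n) : n ^ 4 < 2 ^ (n - 2) := by
  induction n, hn using Nat.le_induction with
  | base => norm_num
  | succ k hk ih =>
    have h1 : (k + 1) ^ 4 ≤ 2 * k ^ 4 := by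
      have h2 : 21 * (k + 1) ≤ 22 * k := by omega
      have h3 := Nat.pow_le_pow_left h2 4
      rw [mul_pow, mul_pow] at h3
      norm_num at h3
      omega
    rw [show k + 1 - 2 = k - 2 + 1 by omega, pow_succ 2]
    omega

theorem choose_two_add_two_sq_lt {n : ℕ} (hn : 21 ≤ n) : (n.choose 2 + 2) ^ 2 < 2 ^ (n - 2) := by
  refine lt_of_le_of_lt ?_ (pow_four_lt_two_pow hn)
  rw [show n ^ 4 = (n ^ 2) ^ 2 by ring]
  refine Nat.pow_le_pow_left ?_ 2
  rw [Nat.choose_two_right, sq]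
  have h1 : n * (n - 1) ≤ n * n := Nat.mul_le_mul_left n (Nat.sub_le n 1)
  have h2 : 21 * 21 ≤ n * n := Nat.mul_le_mul hn hn
  omega

theorem probInter_image (σ : Equiv.Perm ℕ) (p : ℝ) (𝓐 : Finset (Finset ℕ)) :
    probInter p (𝓐.image fun A => A.image σ) = probInter p 𝓐 := by
  have hinj : ∀ τ : Equiv.Perm ℕ, Function.Injective fun A : Finset ℕ => A.image τ := fun τ =>
    image_injective τ.injective
  have hinter : ∀ (τ : Equiv.Perm ℕ) {𝓑 : Finset (Finset ℕ)}, IsInter 𝓑 →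
      IsInter (𝓑.image fun A => A.image τ) := by
    intro τ 𝓑 h B hB B' hB'
    obtain ⟨A, hA, rfl⟩ := mem_image.1 hB
    obtain ⟨A', hA', rfl⟩ := mem_image.1 hB'
    rw [← image_inter _ _ τ.injective]
    exact (h A hA A' hA').image _
  have hsymm : ∀ (τ : Equiv.Perm ℕ) (𝓑 : Finset (Finset ℕ)),
      ((𝓑.image fun A => A.image τ).image fun A => A.image τ.symm) = 𝓑 := by
    intro τ 𝓑
    simp [image_image, Function.comp_def]
  unfold probInter
  symm
  refine sum_nbij' (fun 𝓑 => 𝓑.image fun A => A.image σ)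
    (fun 𝓑 => 𝓑.image fun A => A.image σ.symm) ?_ ?_ (fun 𝓑 _ => hsymm σ 𝓑)
    (fun 𝓑 _ => hsymm σ.symm 𝓑) ?_
  · intro 𝓑 h𝓑
    rw [mem_filter, mem_powerset] at h𝓑 ⊢
    exact ⟨image_subset_image h𝓑.1, hinter σ h𝓑.2⟩
  · intro 𝓑 h𝓑
    rw [mem_filter, mem_powerset] at h𝓑 ⊢
    refine ⟨?_, hinter σ.symm h𝓑.2⟩
    rw [← hsymm σ 𝓐]
    exact image_subset_image h𝓑.1
  · intro 𝓑 _
    rw [card_image_of_injective _ (hinj σ), card_image_of_injective _ (hinj σ)]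

theorem image_layerGE_union_starGraph {n c : ℕ} {σ : Equiv.Perm ℕ} (hc : c ∈ groundSet n)
    (hσ : ∀ x ∈ groundSet n, σ x ∈ groundSet n) :
    ((layerGE n 3 ∪ starGraph n c).image fun A => A.image σ) =
      layerGE n 3 ∪ starGraph n (σ c) := by
  refine eq_of_subset_of_card_le ?_ ?_
  · intro A hA
    obtain ⟨B, hB, rfl⟩ := mem_image.1 hA
    have hsub : B ⊆ groundSet n → B.image σ ⊆ groundSet n := fun h x hx => by
      obtain ⟨y, hy, rfl⟩ := mem_image.1 hx
      exact hσ y (h hy)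
    simp only [mem_union, mem_layerGE, mem_starGraph, card_image_of_injective _ σ.injective]
      at hB ⊢
    exact hB.imp (fun h => ⟨hsub h.1, h.2⟩) fun h =>
      ⟨hsub h.1, h.2.1, mem_image_of_mem _ h.2.2⟩
  · rw [card_image_of_injective _ (image_injective σ.injective),
      card_layerGE_union (starGraph_subset n _), card_layerGE_union (starGraph_subset n c),
      card_starGraph hc, card_starGraph (hσ c hc)]

theorem IsOptimal.exists_perm {n : ℕ} {p : ℝ} {𝓐 : Finset (Finset ℕ)} (hopt : IsOptimal n p 𝓐)
    (hp0 : 0 < p) (hp1 : p < 1) (hn : 21 ≤ n)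
    (hcard : 𝓐.card = (∑ k ∈ Icc 3 n, n.choose k) + (n - 1)) :
    ∃ σ : Equiv.Perm ℕ, (∀ x ∈ groundSet n, σ x ∈ groundSet n) ∧
      𝓐 = (layerGE n 3 ∪ starGraph n 1).image fun A => A.image σ := by
  have h1G : 1 ∈ groundSet n := by
    simp only [groundSet, mem_Icc]
    omega
  have hmiss : (allFams n \ 𝓐).card = n.choose 2 + 2 := by
    rw [card_sdiff_of_subset hopt.1, allFams, card_powerset, card_groundSet, hcard,
      two_pow_eq_sum_Icc_three (by omega)]
    omega
  obtain ⟨𝓗, h𝓗, rfl⟩ := hopt.exists_eq_union hp0 hp1 hn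
    (hmiss ▸ choose_two_add_two_sq_lt hn) hmiss
  have h𝓗card : 𝓗.card = n - 1 := by
    rw [card_layerGE_union h𝓗, card_layerGE] at hcard
    omega
  have h𝓗i : IsInter 𝓗 := by
    intro e₁ he₁ e₂ he₂
    by_contra he
    refine (probInter_lt_starGraph (by omega) hp0 hp1 h𝓗 h𝓗card he₁ he₂ he).not_ge
      (hopt.2 _ (union_subset (filter_subset _ _) fun A hA =>
        mem_allFams.2 (mem_starGraph.1 hA).1) ?_)
    rw [card_layerGE_union (starGraph_subset n 1), card_layerGE_union h𝓗, h𝓗card,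
      card_starGraph h1G]
  rcases exists_common_or_triangle (by omega) h𝓗 h𝓗i with ⟨c, hc, hc𝓗⟩ |
    ⟨a, b, c, -, -, -, rfl⟩
  · have h : 𝓗 = starGraph n c := eq_of_subset_of_card_le
      (fun f hf => mem_filter.2 ⟨h𝓗 hf, hc𝓗 f hf⟩) (by rw [card_starGraph hc, h𝓗card])
    have hσ : ∀ x ∈ groundSet n, Equiv.swap 1 c x ∈ groundSet n := by
      intro x hx
      rw [Equiv.swap_apply_def]
      split_ifs <;> assumption
    refine ⟨Equiv.swap 1 c, hσ, ?_⟩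
    rw [image_layerGE_union_starGraph h1G hσ, Equiv.swap_apply_left, h]
  · have := card_le_three (a := ({a, b} : Finset ℕ)) (b := {b, c}) (c := {a, c})
    omega

theorem stmt2 (n : ℕ) (hn : 21 ≤ n) (p : ℝ) (hp0 : 0 < p) (hp1 : p < 1)
    (𝓐 : Finset (Finset ℕ)) (h𝓐 : 𝓐 ⊆ allFams n)
    (hcard : 𝓐.card = (∑ k ∈ Finset.Icc 3 n, n.choose k) + (n - 1)) :
    (∀ 𝓐' ⊆ allFams n, 𝓐'.card = 𝓐.card → probInter p 𝓐' ≤ probInter p 𝓐) ↔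
      ∃ σ : Equiv.Perm ℕ, (∀ x ∈ groundSet n, σ x ∈ groundSet n) ∧
        𝓐 = (layerGE n 3 ∪ (layerEQ n 2).filter fun A => 1 ∈ A).image
              fun A => A.image σ := by
  constructor
  · intro hmax
    exact IsOptimal.exists_perm ⟨h𝓐, hmax⟩ hp0 hp1 hn hcard
  · rintro ⟨σ, -, hσ⟩
    obtain ⟨𝓜, h𝓜, hmax⟩ := exists_max_image ((allFams n).powersetCard 𝓐.card) (probInter p)
      ⟨𝓐, mem_powersetCard.2 ⟨h𝓐, rfl⟩⟩
    rw [mem_powersetCard] at h𝓜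
    have hopt : IsOptimal n p 𝓜 := ⟨h𝓜.1, fun 𝓐' h h' =>
      hmax 𝓐' (mem_powersetCard.2 ⟨h, h'.trans h𝓜.2⟩)⟩
    obtain ⟨τ, -, hτ⟩ := hopt.exists_perm hp0 hp1 hn (h𝓜.2.trans hcard)
    have heq : probInter p 𝓜 = probInter p 𝓐 := by
      rw [hτ, hσ, probInter_image, probInter_image, starGraph]
    intro 𝓐' h h'
    exact heq ▸ hmax 𝓐' (mem_powersetCard.2 ⟨h, h'⟩)
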